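/- arXiv:1807.10683 — 3 statements merged into one kernel-verified Lean document; each statement's English description precedes it below -/
import Mathlib

section
/- Let R be a strongly primary domain. If the conductor (R : R̂) of R in its complete integral closure R̂ is the zero ideal, then Λ(R) < ∞; that is, there exists k ∈ ℕ such that every nonzero non-unit of R is a product of at most k irreducible elements. -/
section DomainDefs

variable (R : Type*) [CommRing R] [IsDomain R]

/-- The set of lengths of `a ∈ R•`: all `k` such that `a` is a product of `k`
irreducible elements (up to a unit). -/
def lengthSetD (a : R) : Set ℕ :=
  {k | ∃ s : Multiset R, Multiset.card s = k ∧ (∀ b ∈ s, Irreducible b) ∧ Associated s.prod a}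

/-- `Λ(R)`, the supremum of the minimal factorization lengths of nonzero elements. -/
noncomputable def LambdaD : ℕ∞ :=
  ⨆ (a : R) (_ : a ≠ 0) (_ : (lengthSetD R a).Nonempty), ((sInf (lengthSetD R a) : ℕ) : ℕ∞)

/-- `ρ_k(R)`, the supremum of `sup L(a)` over all nonzero `a` with `k ∈ L(a)`. -/
noncomputable def rhoD (k : ℕ) : ℕ∞ :=
  ⨆ (a : R) (_ : a ≠ 0) (_ : k ∈ lengthSetD R a),
    ⨆ (n : ℕ) (_ : n ∈ lengthSetD R a), (n : ℕ∞)

/-- The elasticity `ρ(R)`. -/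
noncomputable def elasticityD : ENNReal :=
  ⨆ (a : R) (_ : a ≠ 0) (m : ℕ) (_ : m ∈ lengthSetD R a) (n : ℕ) (_ : n ∈ lengthSetD R a),
    (m : ENNReal) / (n : ENNReal)

/-- `z` is a factorization of `a`: a multiset of irreducibles whose product is
associated to `a`. -/
def IsFactorizationD (a : R) (z : Multiset R) : Prop :=
  (∀ v ∈ z, Irreducible v) ∧ Associated z.prod a

/-- The distance between two factorizations: cancel a (maximal) common part (up to
associates) and take the maximum of the lengths of the remaining parts. -/
noncomputable def fdistD (z z' : Multiset R) : ℕ :=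
  sInf {N : ℕ | ∃ x x' v w : Multiset R, z = x + v ∧ z' = x' + w ∧
    Multiset.Rel Associated x x' ∧ max (Multiset.card v) (Multiset.card w) ≤ N}

/-- `N` is a tame bound for the irreducible element `u`. -/
def TameBoundD (u : R) (N : ℕ) : Prop :=
  ∀ a : R, a ≠ 0 → u ∣ a → ∀ z : Multiset R, IsFactorizationD R a z →
    ∃ z' : Multiset R, IsFactorizationD R a z' ∧ (∃ v ∈ z', Associated v u) ∧ fdistD R z z' ≤ N

/-- `R` is locally tame: `t(u) < ∞` for every irreducible `u`. -/
def LocallyTameD : Prop := ∀ u : R, Irreducible u → ∃ N : ℕ, TameBoundD R u N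

/-- `R` is globally tame: `sup { t(u) : u irreducible } < ∞`. -/
def GloballyTameD : Prop := ∃ N : ℕ, ∀ u : R, Irreducible u → TameBoundD R u N

/-- `R` is a strongly primary domain: local with nonzero maximal ideal, and
every nonzero principal ideal contains a power of the maximal ideal. -/
def StronglyPrimaryDomain [IsLocalRing R] : Prop :=
  IsLocalRing.maximalIdeal R ≠ ⊥ ∧
    ∀ r : R, r ≠ 0 → ∃ n : ℕ, 0 < n ∧ IsLocalRing.maximalIdeal R ^ n ≤ Ideal.span {r}

variable (K : Type*) [Field K] [Algebra R K] [IsFractionRing R K]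

/-- `y ∈ K` lies in (the image of) `R`. -/
def inR (y : K) : Prop := ∃ r : R, y = algebraMap R K r

/-- `x ∈ K` lies in the complete integral closure `R̂` of `R`. -/
def inHat (x : K) : Prop :=
  ∃ c : R, c ≠ 0 ∧ ∀ n : ℕ, inR R K (algebraMap R K c * x ^ n)

/-- `z ∈ K` lies in the conductor `(R : R̂)`. -/
def inConductor (z : K) : Prop := ∀ x : K, inHat R K x → inR R K (z * x)

/-- `R̂` is a primary domain, i.e. its monoid of nonzero elements is primary. -/
def HatPrimaryD : Prop :=
  (∃ x : K, inHat R K x ∧ x ≠ 0 ∧ ¬ inHat R K x⁻¹) ∧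
    ∀ a b : K, (inHat R K a ∧ a ≠ 0 ∧ ¬ inHat R K a⁻¹) →
      (inHat R K b ∧ b ≠ 0 ∧ ¬ inHat R K b⁻¹) →
        ∃ n : ℕ, 0 < n ∧ ∃ c : K, inHat R K c ∧ b ^ n = a * c

/-- `R̂` is a valuation domain. -/
def HatValuationD : Prop :=
  ∀ a b : K, inHat R K a → inHat R K b →
    (∃ c : K, inHat R K c ∧ b = a * c) ∨ (∃ c : K, inHat R K c ∧ a = b * c)

/-- An ideal `I` of `R` is divisorial: `I = (R : (R : I))`. -/
def IsDivisorialIdeal (I : Ideal R) : Prop :=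
  ∀ x : R, (∀ z : K, (∀ y ∈ I, inR R K (z * algebraMap R K y)) →
    inR R K (z * algebraMap R K x)) → x ∈ I

/-- `R` is a Mori domain: the ascending chain condition holds for integral
divisorial ideals. -/
def MoriDomain : Prop :=
  ∀ f : ℕ → Ideal R, (∀ n, IsDivisorialIdeal R K (f n)) → (∀ n, f n ≤ f (n + 1)) →
    ∃ n : ℕ, ∀ m : ℕ, n ≤ m → f m = f n

end DomainDefs

/-- `a` is, up to a unit, a product of at most `k` irreducible elements. -/
def HasShortFactorization {R : Type*} [CommMonoid R] (a : R) (k : ℕ) : Prop :=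
  ∃ s : Multiset R, Multiset.card s ≤ k ∧ (∀ b ∈ s, Irreducible b) ∧ Associated s.prod a

theorem HasShortFactorization.mul {R : Type*} [CommMonoid R] {a b : R} {k l : ℕ}
    (ha : HasShortFactorization a k) (hb : HasShortFactorization b l) :
    HasShortFactorization (a * b) (k + l) := by
  obtain ⟨s, hs, hsi, hsa⟩ := ha
  obtain ⟨t, ht, hti, hta⟩ := hb
  refine ⟨s + t, by rw [Multiset.card_add]; omega, fun c hc => ?_, ?_⟩
  · rcases Multiset.mem_add.1 hc with h | h
    exacts [hsi c h, hti c h]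
  · rw [Multiset.prod_add]
    exact hsa.mul_mul hta

theorem HasShortFactorization.of_associated {R : Type*} [CommMonoid R] {a b : R} {k : ℕ}
    (ha : HasShortFactorization a k) (h : Associated a b) : HasShortFactorization b k := by
  obtain ⟨s, hs, hsi, hsa⟩ := ha
  exact ⟨s, hs, hsi, hsa.trans h⟩

theorem HasShortFactorization.mono {R : Type*} [CommMonoid R] {a : R} {k l : ℕ}
    (ha : HasShortFactorization a k) (h : k ≤ l) : HasShortFactorization a l := by
  obtain ⟨s, hs, hsi, hsa⟩ := ha
  exact ⟨s, hs.trans h, hsi, hsa⟩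

theorem HasShortFactorization.exists_eq_prod {R : Type*} [CommMonoid R] {a : R} {k : ℕ}
    (h : HasShortFactorization a k) (ha : ¬ IsUnit a) :
    ∃ s : Multiset R, Multiset.card s ≤ k ∧ (∀ b ∈ s, Irreducible b) ∧ a = s.prod := by
  obtain ⟨s, hs, hsi, u, rfl⟩ := h
  induction s using Multiset.induction with
  | empty => simp at ha
  | cons c t _ =>
    refine ⟨(c * u) ::ₘ t, by simpa using hs, fun b hb => ?_, ?_⟩
    · rcases Multiset.mem_cons.1 hb with rfl | hb
      · exact (irreducible_mul_units u).2 (hsi c (Multiset.mem_cons_self c t))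
      · exact hsi b (Multiset.mem_cons_of_mem hb)
    · simp only [Multiset.prod_cons]
      exact mul_right_comm _ _ _

section LocalDomain

open IsLocalRing

variable {R : Type*} [CommRing R] [IsLocalRing R]

theorem hasShortFactorization_of_notMem_maximalIdeal_pow (n : ℕ) :
    ∀ a : R, a ∉ maximalIdeal R ^ (n + 1) → HasShortFactorization a n := by
  induction n using Nat.strong_induction_on with
  | _ n ih =>
    intro a ha
    by_cases hu : IsUnit a
    · exact ⟨0, by simp, by simp, by simpa using associated_one_iff_isUnit.2 hu |>.symm⟩
    by_cases hirr : Irreducible a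
    · refine ⟨{a}, ?_, by simpa using hirr, by simp⟩
      rcases Nat.eq_zero_or_pos n with rfl | hn
      · exact absurd (by simpa using hu) ha
      · simpa using Nat.succ_le_of_lt hn
    obtain ⟨p, q, rfl, hp, hq⟩ : ∃ p q, a = p * q ∧ ¬ IsUnit p ∧ ¬ IsUnit q := by
      by_contra! h
      exact hirr ⟨hu, fun p q hpq => or_iff_not_imp_left.2 (h p q hpq)⟩
    have key : ∀ p : R, p ∉ maximalIdeal R ^ (n + 1) → ¬ IsUnit p →
        ∃ i, 1 ≤ i ∧ p ∈ maximalIdeal R ^ i ∧ p ∉ maximalIdeal R ^ (i + 1) := by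
      classical
      intro p hpn hp
      have hex : ∃ i, p ∉ maximalIdeal R ^ (i + 1) := ⟨n, hpn⟩
      have h1 : 1 ≤ Nat.find hex := by
        rw [Nat.one_le_iff_ne_zero]
        intro h0
        have := Nat.find_spec hex
        rw [h0] at this
        exact this (by simpa using hp)
      refine ⟨Nat.find hex, h1, ?_, Nat.find_spec hex⟩
      have := not_not.1 (Nat.find_min hex (Nat.sub_lt h1 one_pos))
      rwa [Nat.sub_add_cancel h1] at this
    obtain ⟨i, hi, hpi, hpi'⟩ := key p (fun h => ha (Ideal.mul_mem_right _ _ h)) hp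
    obtain ⟨j, hj, hqj, hqj'⟩ := key q (fun h => ha (Ideal.mul_mem_left _ _ h)) hq
    have hij : i + j ≤ n := by
      by_contra! h
      refine ha (Ideal.pow_le_pow_right h ?_)
      rw [pow_add]
      exact Ideal.mul_mem_mul hpi hqj
    exact ((ih i (by omega) p hpi').mul (ih j (by omega) q hqj')).mono hij

theorem notMem_maximalIdeal_pow_succ [IsDomain R] {a : R} (ha : a ≠ 0) {n : ℕ}
    (h : maximalIdeal R ^ n ≤ Ideal.span {a}) : a ∉ maximalIdeal R ^ (n + 1) := by
  intro hmem
  rw [pow_succ] at hmem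
  obtain ⟨m, hm, hma⟩ := Ideal.mem_span_singleton_mul.1 (Ideal.mul_mono_left h hmem)
  rw [mul_eq_left₀ ha] at hma
  subst hma
  exact (maximalIdeal.isMaximal R).ne_top ((Ideal.eq_top_iff_one _).2 hm)

variable [IsDomain R] {K : Type*} [Field K] [Algebra R K] [IsFractionRing R K]

theorem exists_sq_eq_pow_mul (hsp : StronglyPrimaryDomain R)
    (hcond : ∀ z : K, inConductor R K z → z = 0) {b : R} (hb : b ≠ 0)
    (hbM : b ∈ maximalIdeal R) (j : ℕ) :
    ∃ y m : R, ¬ b ∣ y ∧ m ∈ maximalIdeal R ∧ y ^ 2 = b ^ (2 * j) * m := by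
  classical
  set φ := algebraMap R K
  have hφ : Function.Injective φ := IsFractionRing.injective R K
  obtain ⟨x, ⟨c, hc, hcx⟩, hx⟩ : ∃ x : K, inHat R K x ∧ ¬ inR R K (φ (b ^ (2 * j)) * x) := by
    by_contra! h
    exact pow_ne_zero (2 * j) hb (hφ ((hcond _ h).trans (map_zero φ).symm))
  have hex : ∃ N, ∀ r, inR R K (φ (b ^ (2 * j + N)) * x ^ r) := by
    obtain ⟨N, -, hN⟩ := hsp.2 c hc
    obtain ⟨d, hd⟩ := Ideal.mem_span_singleton.1 (hN (Ideal.pow_mem_pow hbM N))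
    refine ⟨N, fun r => ?_⟩
    obtain ⟨e, he⟩ := hcx r
    refine ⟨b ^ (2 * j) * d * e, ?_⟩
    rw [map_mul, ← he, pow_add, hd]
    simp only [map_mul, φ]
    ring
  obtain ⟨N, hN⟩ : ∃ N, Nat.find hex = N + 1 := Nat.exists_eq_succ_of_ne_zero fun h0 => by
    have := Nat.find_spec hex 1
    rw [h0, add_zero, pow_one] at this
    exact hx this
  have hspec := Nat.find_spec hex
  rw [hN] at hspec
  have hmin := Nat.find_min hex (m := N) (by omega)
  push Not at hmin
  obtain ⟨r, hr⟩ := hmin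
  obtain ⟨y, hy⟩ := hspec r
  obtain ⟨e, he⟩ := hspec (r * 2)
  refine ⟨y, b ^ (N + 1) * e, ?_, Ideal.mul_mem_right _ _ (Ideal.pow_mem_of_mem _ hbM _ (by omega)),
    hφ ?_⟩
  · rintro ⟨w, rfl⟩
    refine hr ⟨w, mul_left_cancel₀ ((map_ne_zero_iff φ hφ).2 hb) ?_⟩
    rw [← map_mul, ← hy, ← add_assoc, pow_succ, map_mul]
    ring
  · have he' : φ e = φ (b ^ (2 * j + (N + 1))) * x ^ (r * 2) := he.symm
    have hy' : φ y = φ (b ^ (2 * j + (N + 1))) * x ^ r := hy.symm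
    simp only [map_mul, map_pow] at he' hy' ⊢
    rw [he', hy']
    ring

theorem hasShortFactorization_pow_two_mul (hsp : StronglyPrimaryDomain R)
    (hcond : ∀ z : K, inConductor R K z → z = 0) {b : R} (hb : b ≠ 0)
    (hbM : b ∈ maximalIdeal R) {n : ℕ} (hn : ∀ a, ¬ b ∣ a → HasShortFactorization a n) (j : ℕ) :
    HasShortFactorization (b ^ (2 * j)) (n + n) := by
  rcases Nat.eq_zero_or_pos j with rfl | hj
  · exact ⟨0, by simp, by simp, by simp⟩
  obtain ⟨y, m, hy, hm, hym⟩ := exists_sq_eq_pow_mul hsp hcond hb hbM j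
  have hbj : b ∣ b ^ j := dvd_pow_self b hj.ne'
  refine ((hn (b ^ j + y) fun h => hy ((dvd_add_right hbj).1 h)).mul
    (hn (b ^ j - y) fun h => hy ((dvd_sub_right hbj).1 h))).of_associated ?_
  have hu : IsUnit (1 - m) := by
    by_contra h
    exact (maximalIdeal.isMaximal R).ne_top ((Ideal.eq_top_iff_one _).2 (by
      simpa using add_mem ((mem_maximalIdeal _).2 h) hm))
  have hprod : (b ^ j + y) * (b ^ j - y) = b ^ (2 * j) * (1 - m) := by
    linear_combination -hym
  rw [hprod]
  exact associated_mul_unit_left _ _ hu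

theorem exists_forall_hasShortFactorization (hsp : StronglyPrimaryDomain R)
    (hcond : ∀ z : K, inConductor R K z → z = 0) :
    ∃ k : ℕ, ∀ a : R, a ≠ 0 → HasShortFactorization a k := by
  obtain ⟨b, hbM, hb⟩ := Submodule.exists_mem_ne_zero_of_ne_bot hsp.1
  obtain ⟨n, -, hn⟩ := hsp.2 b hb
  have hndvd : ∀ a, ¬ b ∣ a → HasShortFactorization a n := fun a ha =>
    hasShortFactorization_of_notMem_maximalIdeal_pow n a fun h =>
      ha (Ideal.mem_span_singleton.1 (hn (Ideal.pow_le_pow_right n.le_succ h)))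
  have hbn : HasShortFactorization b n :=
    hasShortFactorization_of_notMem_maximalIdeal_pow n b (notMem_maximalIdeal_pow_succ hb hn)
  have hpow : ∀ j, HasShortFactorization (b ^ j) (n + n + n) := fun j => by
    have heven := hasShortFactorization_pow_two_mul hsp hcond hb hbM hndvd (j / 2)
    rcases Nat.mod_two_eq_zero_or_one j with h | h
    · rw [show j = 2 * (j / 2) by omega]
      exact heven.mono (by omega)
    · rw [show j = 2 * (j / 2) + 1 by omega, pow_succ]
      exact heven.mul hbn
  refine ⟨n + n + n + n, fun a ha => ?_⟩
  obtain ⟨l, -, hl⟩ := hsp.2 a ha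
  have hfin : FiniteMultiplicity b a := ⟨l, fun h =>
    notMem_maximalIdeal_pow_succ ha hl
      (Ideal.mem_of_dvd _ h (Ideal.pow_mem_pow hbM _))⟩
  obtain ⟨c, hac, hc⟩ := hfin.exists_eq_pow_mul_and_not_dvd
  rw [hac]
  exact (hpow _).mul (hndvd c hc)

end LocalDomain

/-- Let `R` be a strongly primary domain. If the conductor `(R : R̂)`
is the zero ideal, then `Λ(R) < ∞`: there exists `k ∈ ℕ` such that every nonzero
non-unit of `R` is a product of at most `k` irreducible elements. -/
theorem stmt0 (R : Type*) [CommRing R] [IsDomain R] [IsLocalRing R]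
    (K : Type*) [Field K] [Algebra R K] [IsFractionRing R K]
    (hsp : StronglyPrimaryDomain R)
    (hcond : ∀ z : K, inConductor R K z → z = 0) :
    LambdaD R < ⊤ ∧ ∃ k : ℕ, ∀ a : R, a ≠ 0 → ¬ IsUnit a →
      ∃ s : Multiset R, Multiset.card s ≤ k ∧ (∀ b ∈ s, Irreducible b) ∧ a = s.prod := by
  obtain ⟨k, hk⟩ := exists_forall_hasShortFactorization hsp hcond
  refine ⟨lt_of_le_of_lt (iSup_le fun a => iSup_le fun ha => iSup_le fun _ => ?_)
    (ENat.natCast_lt_top k), k, fun a ha hu => (hk a ha).exists_eq_prod hu⟩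
  obtain ⟨s, hs, hsi, hsa⟩ := hk a ha
  have hlen : Multiset.card s ∈ lengthSetD R a := ⟨s, rfl, hsi, hsa⟩
  exact Nat.cast_le.2 ((Nat.sInf_le hlen).trans hs)
end

section
/- Every strongly primary domain is locally tame. -/
open IsLocalRing

section BoundedFactorizations

variable {R : Type*} [CommRing R]

/-- `a` is, up to a unit, a product of at most `N` irreducible elements. -/
def HasFactorizationLE (N : ℕ) (a : R) : Prop :=
  ∃ s : Multiset R, Multiset.card s ≤ N ∧ IsFactorizationD R a s

namespace HasFactorizationLE

lemma mono {N N' : ℕ} {a : R} (h : HasFactorizationLE N a) (hN : N ≤ N') :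
    HasFactorizationLE N' a := by
  obtain ⟨s, hs, hf⟩ := h
  exact ⟨s, hs.trans hN, hf⟩

lemma of_associated {N : ℕ} {a b : R} (h : HasFactorizationLE N a) (hab : Associated a b) :
    HasFactorizationLE N b := by
  obtain ⟨s, hs, hirr, hprod⟩ := h
  exact ⟨s, hs, hirr, hprod.trans hab⟩

lemma of_isUnit {N : ℕ} {a : R} (h : IsUnit a) : HasFactorizationLE N a :=
  ⟨0, by simp, by simp, by simpa using (associated_one_iff_isUnit.2 h).symm⟩

lemma of_irreducible {a : R} (h : Irreducible a) : HasFactorizationLE 1 a :=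
  ⟨{a}, by simp, by simpa using h, by simp⟩

lemma mul {N N' : ℕ} {a b : R} (ha : HasFactorizationLE N a) (hb : HasFactorizationLE N' b) :
    HasFactorizationLE (N + N') (a * b) := by
  obtain ⟨s, hs, hirr, hprod⟩ := ha
  obtain ⟨t, ht, hirr', hprod'⟩ := hb
  refine ⟨s + t, by simpa using add_le_add hs ht, ?_, by simpa using hprod.mul_mul hprod'⟩
  intro v hv
  rcases Multiset.mem_add.1 hv with h | h
  exacts [hirr v h, hirr' v h]

lemma pow {N : ℕ} {a : R} (ha : HasFactorizationLE N a) (k : ℕ) :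
    HasFactorizationLE (k * N) (a ^ k) := by
  induction k with
  | zero => exact of_isUnit (by simp)
  | succ k ih =>
    rw [pow_succ, Nat.succ_mul]
    exact ih.mul ha

lemma of_mem_maximalIdeal [IsLocalRing R] (n : ℕ) {a : R} (ha : a ∈ maximalIdeal R)
    (hn : a ∉ maximalIdeal R ^ (n + 1)) : HasFactorizationLE n a := by
  induction n using Nat.strong_induction_on generalizing a with
  | _ n ih =>
    have hn0 : 1 ≤ n := by
      by_contra h
      obtain rfl : n = 0 := by omega
      exact hn (by simpa using ha)
    by_cases hirr : Irreducible a
    · exact (of_irreducible hirr).mono hn0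
    have hdec : ∃ x y : R, a = x * y ∧ ¬ IsUnit x ∧ ¬ IsUnit y := by
      by_contra! h
      refine hirr ⟨(mem_maximalIdeal a).1 ha, fun {x y} hxy => ?_⟩
      by_contra! hu
      exact hu.2 (h x y hxy hu.1)
    obtain ⟨x, y, rfl, hx, hy⟩ := hdec
    have key : ∀ w : R, ¬ IsUnit w → w ∉ maximalIdeal R ^ (n + 1) →
        ∃ p, 1 ≤ p ∧ w ∈ maximalIdeal R ^ p ∧ w ∉ maximalIdeal R ^ (p + 1) := by
      intro w hw hw'
      classical
      have hex : ∃ p, w ∉ maximalIdeal R ^ p := ⟨_, hw'⟩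
      have hmem : w ∈ maximalIdeal R := (mem_maximalIdeal w).2 hw
      have h2 : 2 ≤ Nat.find hex := by
        rw [Nat.le_find_iff]
        intro m hm
        interval_cases m <;> simp [hmem]
      refine ⟨Nat.find hex - 1, by omega, ?_, ?_⟩
      · exact not_not.1 (Nat.find_min hex (m := Nat.find hex - 1) (by omega))
      · rw [Nat.sub_add_cancel (by omega)]
        exact Nat.find_spec hex
    obtain ⟨p, hp, hxp, hxp'⟩ := key x hx fun h => hn (Ideal.mul_mem_right _ _ h)
    obtain ⟨q, hq, hyq, hyq'⟩ := key y hy fun h => hn (Ideal.mul_mem_left _ _ h)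
    have hpq : p + q ≤ n := by
      by_contra h
      refine hn (Ideal.pow_le_pow_right (show n + 1 ≤ p + q by omega) ?_)
      rw [pow_add]
      exact Ideal.mul_mem_mul hxp hyq
    exact ((ih p (by omega) ((mem_maximalIdeal x).2 hx) hxp').mul
      (ih q (by omega) ((mem_maximalIdeal y).2 hy) hyq')).mono hpq

lemma of_notMem_pow [IsLocalRing R] {n : ℕ} {a : R}
    (hn : a ∉ maximalIdeal R ^ n) : HasFactorizationLE n a := by
  by_cases hu : IsUnit a
  · exact of_isUnit hu
  cases n with
  | zero => simp at hn
  | succ n => exact (of_mem_maximalIdeal n ((mem_maximalIdeal a).2 hu) hn).mono n.le_succ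

end HasFactorizationLE

end BoundedFactorizations

lemma not_dvd_of_notMem_range {R K : Type*} [CommRing R] [Field K] [Algebra R K]
    [IsFractionRing R K] {f p : R} (hf0 : f ≠ 0) {m : ℕ} {x : K}
    (hp : algebraMap R K p = algebraMap R K f ^ (m + 1) * x)
    (hx : algebraMap R K f ^ m * x ∉ (algebraMap R K).range) : ¬ f ∣ p := by
  rintro ⟨c, rfl⟩
  have hf1 : algebraMap R K f ≠ 0 := by simpa using hf0
  refine hx ⟨c, mul_left_cancel₀ hf1 ?_⟩
  rw [← map_mul, hp]
  ring

namespace StronglyPrimaryDomain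

variable {R : Type*} [CommRing R] [IsLocalRing R]
  {K : Type*} [Field K] [Algebra R K] [IsFractionRing R K]

lemma exists_dvd_pow (hsp : StronglyPrimaryDomain R) {f : R} (hf : f ∈ maximalIdeal R)
    {a : R} (ha : a ≠ 0) : ∃ k, a ∣ f ^ k := by
  obtain ⟨n, -, hn⟩ := hsp.2 a ha
  exact ⟨n, Ideal.mem_span_singleton.1 (hn (Ideal.pow_mem_pow hf n))⟩

lemma hasFactorizationLE_of_not_dvd {f : R} {n : ℕ}
    (hn : maximalIdeal R ^ n ≤ Ideal.span {f}) {a : R} (ha : ¬ f ∣ a) :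
    HasFactorizationLE n a :=
  .of_notMem_pow fun h => ha (Ideal.mem_span_singleton.1 (hn h))

lemma exists_pow_mul_mem_range (hsp : StronglyPrimaryDomain R) {f : R} (hf : f ∈ maximalIdeal R)
    (x : K) : ∃ k, algebraMap R K f ^ k * x ∈ (algebraMap R K).range := by
  obtain ⟨a, b, hb, rfl⟩ := IsFractionRing.div_surjective (A := R) x
  have hb0 : b ≠ 0 := nonZeroDivisors.ne_zero hb
  obtain ⟨k, c, hc⟩ := hsp.exists_dvd_pow hf hb0
  have hb1 : algebraMap R K b ≠ 0 := by simpa using hb0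
  refine ⟨k, c * a, ?_⟩
  rw [← map_pow, hc, map_mul, map_mul]
  field_simp

/-- If `z` is topologically nilpotent and `z` has strictly larger denominator than all of its
higher powers, then `f ^ (2 * (m + 1))` is the product of the numerators of `1 - z` and
`(1 - z)⁻¹`, neither of which is divisible by `f`. -/
lemma hasFactorizationLE_pow_of_denominator {f : R}
    (hf : f ∈ maximalIdeal R) (hf0 : f ≠ 0) {n : ℕ} (hn : maximalIdeal R ^ n ≤ Ideal.span {f})
    {m r : ℕ} {z : K} {c : R} (hr : r ≠ 0) (hzr : z ^ r = algebraMap R K (f * c))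
    (hz : algebraMap R K f ^ (m + 1) * z ∈ (algebraMap R K).range)
    (hz' : algebraMap R K f ^ m * z ∉ (algebraMap R K).range)
    (hzl : ∀ l, 2 ≤ l → algebraMap R K f ^ m * z ^ l ∈ (algebraMap R K).range) :
    HasFactorizationLE (n + n) (f ^ (2 * (m + 1))) := by
  have hfA (k : ℕ) : algebraMap R K f ^ k ∈ (algebraMap R K).range := ⟨f ^ k, map_pow _ _ _⟩
  obtain ⟨r, rfl⟩ : ∃ k, r = k + 2 := by
    refine ⟨r - 2, ?_⟩
    have : r ≠ 1 := by
      rintro rfl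
      refine hz' (mul_mem (hfA m) ⟨f * c, ?_⟩)
      rw [← hzr, pow_one]
    omega
  have htail : algebraMap R K f ^ m * ∑ l ∈ Finset.range r, z ^ (l + 2) ∈
      (algebraMap R K).range := by
    rw [Finset.mul_sum]
    exact sum_mem fun l _ => hzl (l + 2) (by omega)
  have hsum : ∑ l ∈ Finset.range (r + 2), z ^ l =
      1 + z + ∑ l ∈ Finset.range r, z ^ (l + 2) := by
    rw [Finset.sum_range_succ', Finset.sum_range_succ']
    ring
  obtain ⟨p, hp⟩ : algebraMap R K f ^ (m + 1) * (1 - z) ∈ (algebraMap R K).range := by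
    rw [mul_sub, mul_one]
    exact sub_mem (hfA _) hz
  obtain ⟨q, hq⟩ : algebraMap R K f ^ (m + 1) * ∑ l ∈ Finset.range (r + 2), z ^ l ∈
      (algebraMap R K).range := by
    rw [hsum, mul_add, mul_add, mul_one]
    refine add_mem (add_mem (hfA _) hz) ?_
    rw [pow_succ', mul_assoc]
    exact mul_mem ⟨f, rfl⟩ htail
  have hfp : ¬ f ∣ p := by
    refine not_dvd_of_notMem_range hf0 hp fun h => hz' ?_
    convert sub_mem (hfA m) h using 1
    ring
  have hfq : ¬ f ∣ q := by
    refine not_dvd_of_notMem_range hf0 hq fun h => hz' ?_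
    rw [hsum] at h
    convert sub_mem (sub_mem h (hfA m)) htail using 1
    ring
  have hpq : p * q = f ^ (2 * (m + 1)) * (1 - f * c) := by
    refine IsFractionRing.injective R K ?_
    rw [map_mul, hp, hq, map_mul, map_sub, ← hzr, map_one, map_pow,
      ← mul_neg_geom_sum z (r + 2)]
    ring
  have hu : IsUnit (1 - f * c) := by
    by_contra h
    have h1 := add_mem ((mem_maximalIdeal _).2 h) (Ideal.mul_mem_right c _ hf)
    rw [sub_add_cancel] at h1
    exact (mem_maximalIdeal _).1 h1 isUnit_one
  refine ((hasFactorizationLE_of_not_dvd hn hfp).mul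
    (hasFactorizationLE_of_not_dvd hn hfq)).of_associated ?_
  rw [hpq]
  exact associated_mul_unit_left _ _ hu

/-- If some power of `f` has no short factorization, then the denominators of topologically
nilpotent elements of the quotient field are bounded. -/
lemma pow_mul_mem_range_of_pow_eq (hsp : StronglyPrimaryDomain R) {f : R}
    (hf : f ∈ maximalIdeal R) (hf0 : f ≠ 0) {n : ℕ} (hn : maximalIdeal R ^ n ≤ Ideal.span {f})
    {m : ℕ} (hm : ¬ HasFactorizationLE (n + n) (f ^ (2 * m)))
    {r : ℕ} {y : K} {c : R} (hr : r ≠ 0) (hyr : y ^ r = algebraMap R K (f * c)) :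
    algebraMap R K f ^ m * y ∈ (algebraMap R K).range := by
  classical
  have hfA (k : ℕ) : algebraMap R K f ^ k ∈ (algebraMap R K).range := ⟨f ^ k, map_pow _ _ _⟩
  have hmono {a b : ℕ} (hab : a ≤ b) {x : K}
      (hx : algebraMap R K f ^ a * x ∈ (algebraMap R K).range) :
      algebraMap R K f ^ b * x ∈ (algebraMap R K).range := by
    have := mul_mem (hfA (b - a)) hx
    rwa [← mul_assoc, ← pow_add, Nat.sub_add_cancel hab] at this
  choose k hk using fun t : ℕ => hsp.exists_pow_mul_mem_range hf (y ^ t)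
  set N := (Finset.range r).sup k
  have hlt (t : ℕ) (ht : t < r) : algebraMap R K f ^ N * y ^ t ∈ (algebraMap R K).range :=
    hmono (Finset.le_sup (Finset.mem_range.2 ht)) (hk t)
  have hdiv (l : ℕ) : y ^ l = algebraMap R K (f * c) ^ (l / r) * y ^ (l % r) := by
    rw [← hyr, ← pow_mul, ← pow_add, Nat.div_add_mod]
  have hall (l : ℕ) : algebraMap R K f ^ N * y ^ l ∈ (algebraMap R K).range := by
    rw [hdiv, mul_left_comm]
    exact mul_mem (pow_mem (Set.mem_range_self _) _) (hlt _ (Nat.mod_lt _ (Nat.pos_of_ne_zero hr)))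
  have hlarge (l : ℕ) (hl : r * N ≤ l) : y ^ l ∈ (algebraMap R K).range := by
    have hq : N ≤ l / r := by
      rw [Nat.le_div_iff_mul_le (Nat.pos_of_ne_zero hr), mul_comm]
      exact hl
    rw [hdiv, map_mul, mul_pow, mul_right_comm]
    exact mul_mem (hmono hq (hlt _ (Nat.mod_lt _ (Nat.pos_of_ne_zero hr))))
      (pow_mem (Set.mem_range_self _) _)
  have hex : ∃ S, ∀ l, algebraMap R K f ^ S * y ^ l ∈ (algebraMap R K).range := ⟨N, hall⟩
  obtain ⟨S, hS, hmin⟩ : ∃ S, (∀ l, algebraMap R K f ^ S * y ^ l ∈ (algebraMap R K).range) ∧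
      ∀ S' < S, ¬ ∀ l, algebraMap R K f ^ S' * y ^ l ∈ (algebraMap R K).range :=
    ⟨Nat.find hex, Nat.find_spec hex, fun _ => Nat.find_min hex⟩
  by_cases hSm : S ≤ m
  · simpa using hmono hSm (hS 1)
  obtain ⟨m, rfl⟩ : ∃ k, m = k + 1 := by
    refine Nat.exists_eq_succ_of_ne_zero ?_
    rintro rfl
    exact hm (.of_isUnit (by simp))
  obtain ⟨d, rfl⟩ : ∃ d, S = m + d + 1 := ⟨S - (m + 1), by omega⟩
  obtain ⟨l₀, hl₀⟩ := not_forall.1 (hmin (m + d) (by omega))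
  have hbound (l : ℕ) (hl : algebraMap R K f ^ (m + d) * y ^ l ∉ (algebraMap R K).range) :
      l ≤ r * N := by
    by_contra! h
    exact hl (mul_mem (hfA _) (hlarge l h.le))
  set P : ℕ → Prop := fun l => algebraMap R K f ^ (m + d) * y ^ l ∉ (algebraMap R K).range
  set i := Nat.findGreatest P (r * N)
  have hPi : P i := Nat.findGreatest_spec (hbound l₀ hl₀) hl₀
  have hgt (l : ℕ) (hl : i < l) :
      algebraMap R K f ^ (m + d) * y ^ l ∈ (algebraMap R K).range := by
    by_contra h
    exact absurd (Nat.le_findGreatest (P := P) (hbound l h) h) (by omega)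
  have hi0 : i ≠ 0 := by
    intro h0
    rw [h0] at hPi
    exact hPi (by simpa using hfA (m + d))
  obtain ⟨i', hi'⟩ := Nat.exists_eq_succ_of_ne_zero hi0
  refine absurd (hasFactorizationLE_pow_of_denominator (K := K) hf hf0 hn (m := m) (r := r)
    (z := algebraMap R K f ^ d * y ^ i) (c := (f ^ d) ^ r * (f * c) ^ i' * c) hr ?_ ?_ ?_ ?_) hm
  · rw [mul_pow, ← pow_mul y, mul_comm i r, pow_mul, hyr, hi', ← map_pow, ← map_pow, ← map_pow,
      ← map_mul]
    congr 1
    rw [pow_succ]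
    ring
  · rw [← mul_assoc, ← pow_add, add_right_comm]
    exact hS i
  · rw [← mul_assoc, ← pow_add]
    exact hPi
  · intro l hl
    rw [mul_pow, ← mul_assoc, ← pow_mul, ← pow_add, ← pow_mul]
    refine hmono (show m + d ≤ m + d * l from ?_) (hgt _ ?_)
    · exact Nat.add_le_add_left (Nat.le_mul_of_pos_right d (by omega)) m
    · nlinarith [Nat.pos_of_ne_zero hi0]

variable [IsDomain R]

lemma exists_notMem_pow (hsp : StronglyPrimaryDomain R) {a : R} (ha : a ≠ 0) :
    ∃ n, a ∉ maximalIdeal R ^ n := by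
  obtain ⟨g, hg, hg0⟩ := Submodule.exists_mem_ne_zero_of_ne_bot hsp.1
  obtain ⟨n, -, hn⟩ := hsp.2 (a * g) (mul_ne_zero ha hg0)
  refine ⟨n, fun h => ?_⟩
  obtain ⟨c, hc⟩ := Ideal.mem_span_singleton.1 (hn h)
  refine (mem_maximalIdeal g).1 hg (IsUnit.of_mul_eq_one c ?_)
  refine mul_left_cancel₀ ha ?_
  rw [← mul_assoc, ← hc, mul_one]

lemma finiteMultiplicity (hsp : StronglyPrimaryDomain R) {f : R} (hf : f ∈ maximalIdeal R)
    {a : R} (ha : a ≠ 0) : FiniteMultiplicity f a := by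
  obtain ⟨n, hn⟩ := hsp.exists_notMem_pow ha
  refine ⟨n, fun h => hn ?_⟩
  exact Ideal.mem_of_dvd _ ((pow_dvd_pow f n.le_succ).trans h) (Ideal.pow_mem_pow hf n)

lemma exists_hasFactorizationLE (hsp : StronglyPrimaryDomain R) {a : R} (ha : a ≠ 0) :
    ∃ n, HasFactorizationLE n a :=
  (hsp.exists_notMem_pow ha).imp fun _ => .of_notMem_pow

/-- If the powers of `b` drift arbitrarily far from the powers of `f`, then the powers of `f`
have factorizations of bounded length. -/
lemma exists_bound_of_powers_unbounded (hsp : StronglyPrimaryDomain R) {f : R}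
    (hf : f ∈ maximalIdeal R) (hf0 : f ≠ 0) {b : R} (hb : b ≠ 0)
    (h : ∀ C, ∃ i, ∀ s, f ^ s ∣ b ^ i → ¬ b ^ i ∣ f ^ (s + C)) :
    ∃ N, ∀ j, HasFactorizationLE N (f ^ j) := by
  classical
  obtain ⟨n, -, hn⟩ := hsp.2 f hf0
  obtain ⟨L, hL⟩ := hsp.exists_hasFactorizationLE hf0
  obtain ⟨D, hD⟩ := hsp.exists_dvd_pow hf hb
  have hdec (i : ℕ) : ∃ s x, b ^ i = f ^ s * x ∧ ¬ f ∣ x :=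
    ⟨_, (hsp.finiteMultiplicity hf (pow_ne_zero i hb)).exists_eq_pow_mul_and_not_dvd⟩
  choose s x hx hfx using hdec
  have hx0 (i : ℕ) : x i ≠ 0 := fun h0 => hfx i (h0 ▸ dvd_zero f)
  have hdvd (i : ℕ) : ∃ k, x i ∣ f ^ k := hsp.exists_dvd_pow hf (hx0 i)
  have hunb (j : ℕ) : ∃ i, ¬ x i ∣ f ^ j := by
    obtain ⟨i, hi⟩ := h j
    refine ⟨i, fun hd => hi (s i) ⟨x i, hx i⟩ ?_⟩
    rw [hx, pow_add]
    exact mul_dvd_mul_left _ hd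
  have hstep (i t : ℕ) (hi : x i ∣ f ^ t) : x (i + 1) ∣ f ^ (t + D) := by
    have hs : s i ≤ s (i + 1) := by
      by_contra! hlt
      have h1 : f ^ (s (i + 1)) * f ∣ f ^ (s (i + 1)) * x (i + 1) := by
        rw [← hx (i + 1), ← pow_succ, pow_succ b]
        exact ((pow_dvd_pow f hlt).trans ⟨x i, hx i⟩).mul_right b
      exact hfx (i + 1) ((mul_dvd_mul_iff_left (pow_ne_zero _ hf0)).1 h1)
    refine (mul_dvd_mul_iff_left (pow_ne_zero (s (i + 1)) hf0)).1 ?_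
    rw [← hx (i + 1), pow_succ b, hx i, pow_add, ← mul_assoc]
    exact mul_dvd_mul (mul_dvd_mul (pow_dvd_pow f hs) hi) hD
  refine ⟨n + n + D * L, fun j => ?_⟩
  have hi0 : Nat.find (hunb j) ≠ 0 := by
    intro h0
    have hd := Nat.find_spec (hunb j)
    rw [h0] at hd
    exact hd (((Dvd.intro_left _ (hx 0).symm).trans (by simp : b ^ 0 ∣ 1)).trans (one_dvd _))
  obtain ⟨i, hi⟩ := Nat.exists_eq_succ_of_ne_zero hi0
  have hij : x i ∣ f ^ j := not_not.1 (Nat.find_min (hunb j) (by omega : i < Nat.find (hunb j)))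
  have hij' : ¬ x (i + 1) ∣ f ^ j := by
    have := Nat.find_spec (hunb j)
    rwa [hi] at this
  set t := Nat.find (hdvd i)
  have hxt : x i ∣ f ^ t := Nat.find_spec (hdvd i)
  have htj : t ≤ j := Nat.find_le hij
  have hjt : j - t ≤ D := by
    by_contra! hlt
    exact hij' ((hstep i t hxt).trans (pow_dvd_pow f (by omega)))
  have hft : HasFactorizationLE (n + n) (f ^ t) := by
    obtain h0 | h0 := Nat.eq_zero_or_pos t
    · rw [h0]
      exact .of_isUnit (by simp)
    obtain ⟨e, he⟩ := hxt
    have hfe : ¬ f ∣ e := by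
      rintro ⟨e', rfl⟩
      refine Nat.find_min (hdvd i) (show t - 1 < Nat.find (hdvd i) by omega) ⟨e', ?_⟩
      refine mul_right_cancel₀ hf0 ?_
      rw [← pow_succ, Nat.sub_add_cancel h0, he]
      ring
    rw [he]
    exact (hasFactorizationLE_of_not_dvd hn (hfx i)).mul (hasFactorizationLE_of_not_dvd hn hfe)
  have := (hft.mul (hL.pow (j - t))).mono (Nat.add_le_add_left (Nat.mul_le_mul_right L hjt) (n + n))
  rwa [← pow_add, Nat.add_sub_cancel' htj] at this

/-- Either the powers of `f` have factorizations of bounded length, or all elements not divisible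
by `f` divide a common power of `f`. -/
lemma exists_bound_or_dvd_pow (hsp : StronglyPrimaryDomain R) {f : R}
    (hf : f ∈ maximalIdeal R) (hf0 : f ≠ 0) :
    (∃ N, ∀ j, HasFactorizationLE N (f ^ j)) ∨ ∃ T, ∀ b, ¬ f ∣ b → b ∣ f ^ T := by
  refine or_iff_not_imp_left.2 fun hunb => ?_
  obtain ⟨n, -, hn⟩ := hsp.2 f hf0
  obtain ⟨m, hm⟩ : ∃ m, ¬ HasFactorizationLE (n + n) (f ^ (2 * m)) := by
    by_contra! h
    obtain ⟨L, hL⟩ := hsp.exists_hasFactorizationLE hf0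
    refine hunb ⟨n + n + L, fun j => ?_⟩
    obtain ⟨k, rfl | rfl⟩ := Nat.even_or_odd' j
    · exact (h k).mono (by omega)
    · rw [pow_succ]
      exact (h k).mul hL
  obtain ⟨K, _, _, _⟩ : ∃ (K : Type _) (_ : Field K) (_ : Algebra R K), IsFractionRing R K :=
    ⟨FractionRing R, inferInstance, inferInstance, inferInstance⟩
  have hinj : Function.Injective (algebraMap R K) := IsFractionRing.injective R K
  have hf1 : algebraMap R K f ≠ 0 := by simpa using hf0
  have key {r : ℕ} {y : K} {c : R} (hr : r ≠ 0) (hyr : y ^ r = algebraMap R K (f * c)) :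
      algebraMap R K f ^ m * y ∈ (algebraMap R K).range :=
    hsp.pow_mul_mem_range_of_pow_eq hf hf0 hn hm hr hyr
  refine ⟨2 * m + 2, fun b hfb => ?_⟩
  have hb : b ≠ 0 := fun h => hfb (h ▸ dvd_zero f)
  have hb1 : algebraMap R K b ≠ 0 := by simpa using hb
  have hlow (r : ℕ) (hr : r ≠ 0) : ¬ f ^ (r * (m + 1) + 1) ∣ b ^ r := by
    rintro ⟨c, hc⟩
    obtain ⟨a, ha⟩ := key (y := algebraMap R K b / algebraMap R K f ^ (m + 1)) (c := c) hr (by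
      rw [div_pow, ← map_pow, hc, map_mul, map_mul, map_pow, div_eq_iff (by positivity)]
      ring)
    refine hfb ⟨a, hinj ?_⟩
    rw [map_mul, ha]
    field_simp
    ring
  obtain ⟨C, hC⟩ : ∃ C, ∀ i, ∃ s, f ^ s ∣ b ^ i ∧ b ^ i ∣ f ^ (s + C) := by
    by_contra! h
    exact hunb (hsp.exists_bound_of_powers_unbounded hf hf0 hb h)
  obtain ⟨s, hs, hs'⟩ := hC (C + 1)
  have hsle : s ≤ (C + 1) * (m + 1) := by
    by_contra! h
    exact hlow (C + 1) (by omega) ((pow_dvd_pow f h).trans hs)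
  obtain ⟨e, he⟩ := hs'.trans (pow_dvd_pow f (Nat.add_le_add_right hsle C))
  obtain ⟨a, ha⟩ := key (r := C + 1) (y := algebraMap R K f ^ (m + 2) / algebraMap R K b)
    (c := e) (by omega) (by
      rw [div_pow, div_eq_iff (pow_ne_zero _ hb1), ← map_pow, ← map_pow, ← map_pow, ← map_mul]
      congr 1
      rw [mul_assoc, mul_comm e, ← he]
      ring)
  refine ⟨a, hinj ?_⟩
  rw [map_mul, ha, map_pow]
  field_simp
  ring

lemma exists_bound_of_dvd_prod (hsp : StronglyPrimaryDomain R) (p : ℕ) :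
    ∃ W, ∀ s : Multiset R, (∀ v ∈ s, Irreducible v) → Multiset.card s ≤ p →
      ∀ c, c ∣ s.prod → HasFactorizationLE W c := by
  obtain ⟨f, hf, hf0⟩ := Submodule.exists_mem_ne_zero_of_ne_bot hsp.1
  obtain ⟨n, -, hn⟩ := hsp.2 f hf0
  obtain ⟨N, hN⟩ | ⟨T, hT⟩ := hsp.exists_bound_or_dvd_pow hf hf0
  · refine ⟨N + n, fun s hs _ c hc => ?_⟩
    have hc0 : c ≠ 0 := ne_zero_of_dvd_ne_zero
      (Multiset.prod_ne_zero fun h => (hs 0 h).ne_zero rfl) hc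
    obtain ⟨x, hx, hfx⟩ := (hsp.finiteMultiplicity hf hc0).exists_eq_pow_mul_and_not_dvd
    rw [hx]
    exact (hN _).mul (hasFactorizationLE_of_not_dvd hn hfx)
  · have hdvd (v : R) (hv : Irreducible v) : v ∣ f ^ (T + 1) := by
      by_cases h : f ∣ v
      · exact ((hv.dvd_iff.1 h).resolve_left ((mem_maximalIdeal f).1 hf)).dvd.trans
          (dvd_pow_self f T.succ_ne_zero)
      · exact (hT v h).trans (pow_dvd_pow f T.le_succ)
    obtain ⟨W, hW⟩ := hsp.exists_notMem_pow (pow_ne_zero ((T + 1) * p) hf0)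
    refine ⟨W, fun s hs hcard c hc => .of_notMem_pow fun h => hW (Ideal.mem_of_dvd _ ?_ h)⟩
    have hprod : s.prod ∣ (f ^ (T + 1)) ^ Multiset.card s := by
      clear hcard hc
      induction s using Multiset.induction with
      | empty => simp
      | cons v s ih =>
        rw [Multiset.prod_cons, Multiset.card_cons, pow_succ']
        exact mul_dvd_mul (hdvd v (hs v (Multiset.mem_cons_self v s)))
          (ih fun w hw => hs w (Multiset.mem_cons_of_mem hw))
    refine (hc.trans hprod).trans ?_
    rw [← pow_mul]
    exact pow_dvd_pow f (Nat.mul_le_mul_left _ hcard)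

end StronglyPrimaryDomain

lemma fdistD_add_left_le {R : Type*} [CommRing R] [IsDomain R] (x v w : Multiset R) :
    fdistD R (x + v) (x + w) ≤ max (Multiset.card v) (Multiset.card w) :=
  Nat.sInf_le ⟨x, x, v, w, rfl, rfl, Multiset.rel_refl_of_refl_on fun a _ => .refl a, le_rfl⟩

lemma multiset_prod_mem_pow {R : Type*} [CommRing R] {I : Ideal R} {s : Multiset R}
    (hs : ∀ v ∈ s, v ∈ I) : s.prod ∈ I ^ Multiset.card s := by
  induction s using Multiset.induction with
  | empty => simp
  | cons v s ih =>
    rw [Multiset.prod_cons, Multiset.card_cons, pow_succ']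
    exact Ideal.mul_mem_mul (hs v (Multiset.mem_cons_self v s))
      (ih fun w hw => hs w (Multiset.mem_cons_of_mem hw))

/-- Every strongly primary domain is locally tame. -/
theorem stmt7 (R : Type*) [CommRing R] [IsDomain R] [IsLocalRing R]
    (hsp : StronglyPrimaryDomain R) :
    LocallyTameD R := by
  classical
  intro u hu
  obtain ⟨p, -, hp⟩ := hsp.2 u hu.ne_zero
  obtain ⟨W, hW⟩ := hsp.exists_bound_of_dvd_prod p
  refine ⟨max p (W + 1), fun a ha hua z hz => ?_⟩
  obtain ⟨hirr, hprod⟩ := hz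
  obtain ⟨z₀, hle, hcard, hdvd⟩ : ∃ z₀ ≤ z, Multiset.card z₀ ≤ p ∧ u ∣ z₀.prod := by
    obtain h | h := le_total (Multiset.card z) p
    · exact ⟨z, le_rfl, h, hua.trans hprod.symm.dvd⟩
    · obtain ⟨z₀, hz₀⟩ : ∃ z₀, z₀ ∈ Multiset.powersetCard p z :=
        Multiset.card_pos_iff_exists_mem.1 (by
          rw [Multiset.card_powersetCard]
          exact Nat.choose_pos h)
      obtain ⟨hle, hcard⟩ := Multiset.mem_powersetCard.1 hz₀
      refine ⟨z₀, hle, hcard.le, Ideal.mem_span_singleton.1 (hp ?_)⟩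
      rw [← hcard]
      exact multiset_prod_mem_pow fun v hv =>
        (mem_maximalIdeal v).2 (hirr v (Multiset.mem_of_le hle hv)).not_isUnit
  obtain ⟨x, rfl⟩ := Multiset.le_iff_exists_add.1 hle
  rw [add_comm] at hirr hprod ⊢
  obtain ⟨c, hc⟩ := hdvd
  obtain ⟨w, hw, hwirr, hwprod⟩ := hW z₀
    (fun v hv => hirr v (Multiset.mem_add.2 (.inr hv))) hcard c (hc ▸ dvd_mul_left c u)
  refine ⟨x + u ::ₘ w, ⟨fun v hv => ?_, ?_⟩, ⟨u, by simp, .refl u⟩, ?_⟩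
  · rcases Multiset.mem_add.1 hv with h | h
    · exact hirr v (Multiset.mem_add.2 (.inl h))
    · rcases Multiset.mem_cons.1 h with rfl | h
      exacts [hu, hwirr v h]
  · refine Associated.trans ?_ hprod
    rw [Multiset.prod_add, Multiset.prod_add, Multiset.prod_cons, hc]
    exact (hwprod.mul_left u).mul_left x.prod
  · refine (fdistD_add_left_le x z₀ (u ::ₘ w)).trans (max_le_max hcard ?_)
    simpa using hw
end

section
/- Every one-dimensional local Mori domain R is locally tame; moreover, such R is globally tame if and only if Λ(R) = ∞. -/
open IsLocalRing

section Mori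

variable {R : Type*} [CommRing R] [IsDomain R] {K : Type*} [Field K] [Algebra R K]

/-- The divisorial closure `(R : (R : I)) ∩ R` of an ideal. -/
def divisorialClosure (R : Type*) [CommRing R] [IsDomain R] (K : Type*) [Field K] [Algebra R K]
    (I : Ideal R) : Ideal R where
  carrier := {x | ∀ z : K, (∀ y ∈ I, inR R K (z * algebraMap R K y)) →
    inR R K (z * algebraMap R K x)}
  zero_mem' := fun z _ => ⟨0, by simp⟩
  add_mem' := by
    intro a b ha hb z hz
    obtain ⟨r, hr⟩ := ha z hz
    obtain ⟨s, hs⟩ := hb z hz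
    exact ⟨r + s, by rw [map_add, mul_add, hr, hs, map_add]⟩
  smul_mem' := by
    intro c a ha z hz
    obtain ⟨r, hr⟩ := ha z hz
    exact ⟨c * r, by rw [smul_eq_mul, map_mul, map_mul, ← hr]; ring⟩

theorem le_divisorialClosure (I : Ideal R) : I ≤ divisorialClosure R K I :=
  fun x hx _ hz => hz x hx

theorem divisorialClosure_mono {I J : Ideal R} (h : I ≤ J) :
    divisorialClosure R K I ≤ divisorialClosure R K J :=
  fun _ hx z hz => hx z fun y hy => hz y (h hy)

theorem isDivisorialIdeal_divisorialClosure (I : Ideal R) :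
    IsDivisorialIdeal R K (divisorialClosure R K I) :=
  fun _ hx z hz => hx z fun _ hy => hy z hz

/-- In a Mori domain every ideal lies in the divisorial closure of a finitely generated
subideal. -/
theorem MoriDomain.exists_fg_le_divisorialClosure (h : MoriDomain R K) (I : Ideal R) :
    ∃ J : Ideal R, J.FG ∧ J ≤ I ∧ I ≤ divisorialClosure R K J := by
  have wf : WellFoundedGT {I : Ideal R // IsDivisorialIdeal R K I} := by
    rw [wellFoundedGT_iff_monotone_chain_condition]
    intro f
    obtain ⟨n, hn⟩ := h (fun n => (f n).1) (fun n => (f n).2) (fun n => f.monotone n.le_succ)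
    exact ⟨n, fun m hm => Subtype.ext (hn m hm).symm⟩
  obtain ⟨_, ⟨J, hfg, hJI, rfl⟩, hmax⟩ := wf.wf.has_min
    {D | ∃ J : Ideal R, J.FG ∧ J ≤ I ∧
      D = ⟨divisorialClosure R K J, isDivisorialIdeal_divisorialClosure J⟩}
    ⟨_, ⊥, Submodule.fg_bot, bot_le, rfl⟩
  refine ⟨J, hfg, hJI, fun x hx => ?_⟩
  by_contra hxJ
  refine hmax _ ⟨J ⊔ Ideal.span {x}, Submodule.FG.sup hfg (Submodule.fg_span_singleton x),
    sup_le hJI ((Ideal.span_singleton_le_iff_mem I).2 hx), rfl⟩ ?_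
  refine lt_of_le_of_ne (divisorialClosure_mono le_sup_left) fun heq => hxJ ?_
  have := congrArg Subtype.val heq
  simp only at this
  rw [this]
  exact le_divisorialClosure _
    ((le_sup_right : Ideal.span {x} ≤ _) (Ideal.mem_span_singleton_self x))

theorem inR_mul_pow_of_le_divisorialClosure {I J : Ideal R} (h : I ≤ divisorialClosure R K J)
    (n : ℕ) : ∀ z : K, (∀ y ∈ J ^ n, inR R K (z * algebraMap R K y)) →
      ∀ y ∈ I ^ n, inR R K (z * algebraMap R K y) := by
  induction n with
  | zero => intro z hz; simpa using hz
  | succ n ih =>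
    intro z hz y hy
    rw [pow_succ] at hy
    induction hy using Submodule.mul_induction_on' with
    | mem_mul_mem a ha b hb =>
      have hzb : ∀ c ∈ J ^ n, inR R K (z * algebraMap R K b * algebraMap R K c) := by
        intro c hc
        have := h hb (z * algebraMap R K c) fun d hd => by
          have := hz (c * d) (by rw [pow_succ]; exact Ideal.mul_mem_mul hc hd)
          rwa [map_mul, ← mul_assoc] at this
        rwa [mul_right_comm]
      have := ih _ hzb a ha
      rwa [map_mul, mul_comm (algebraMap R K a), ← mul_assoc]
    | add a _ b _ ha hb =>
      obtain ⟨r, hr⟩ := ha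
      obtain ⟨s, hs⟩ := hb
      exact ⟨r + s, by rw [map_add, mul_add, hr, hs, map_add]⟩

theorem MoriDomain.stronglyPrimaryDomain [IsLocalRing R] [IsFractionRing R K]
    (hdim : ringKrullDim R = 1) (h : MoriDomain R K) : StronglyPrimaryDomain R := by
  obtain ⟨hf, hrad⟩ := ringKrullDim_eq_one_iff_of_isLocalRing_isDomain.1 hdim
  refine ⟨fun hm => hf (isField_iff_maximalIdeal_eq.2 hm), fun r hr => ?_⟩
  obtain ⟨J, hfg, hJm, hmJ⟩ := h.exists_fg_le_divisorialClosure (maximalIdeal R)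
  obtain ⟨n, hn⟩ := Ideal.exists_pow_le_of_le_radical_of_fg (hJm.trans (hrad r hr)) hfg
  refine ⟨n + 1, n.succ_pos, (Ideal.pow_le_pow_right n.le_succ).trans fun y hy => ?_⟩
  have hr' : algebraMap R K r ≠ 0 := by simpa using hr
  obtain ⟨s, hs⟩ := inR_mul_pow_of_le_divisorialClosure hmJ n (algebraMap R K r)⁻¹
    (fun x hx => by
      obtain ⟨t, rfl⟩ := Ideal.mem_span_singleton.1 (hn hx)
      exact ⟨t, by rw [map_mul]; field_simp⟩) y hy
  refine Ideal.mem_span_singleton.2 ⟨s, IsFractionRing.injective R K ?_⟩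
  rw [map_mul, ← hs]
  field_simp

end Mori

section Factorizations

variable {R : Type*} [CommRing R]

theorem IsFactorizationD.add {a b : R} {y z : Multiset R} (hy : IsFactorizationD R a y)
    (hz : IsFactorizationD R b z) : IsFactorizationD R (a * b) (y + z) := by
  refine ⟨fun v hv => ?_, ?_⟩
  · rcases Multiset.mem_add.1 hv with h | h
    exacts [hy.1 v h, hz.1 v h]
  · rw [Multiset.prod_add]
    exact hy.2.mul_mul hz.2

theorem isFactorizationD_replicate {p : R} (hp : Irreducible p) (n : ℕ) :
    IsFactorizationD R (p ^ n) (Multiset.replicate n p) :=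
  ⟨fun v hv => (Multiset.eq_of_mem_replicate hv).symm ▸ hp, by
    rw [Multiset.prod_replicate]⟩

theorem fdistD_le {z z' : Multiset R} {N : ℕ} (x v w : Multiset R) (hz : z = x + v)
    (hz' : z' = x + w) (hv : Multiset.card v ≤ N) (hw : Multiset.card w ≤ N) :
    fdistD R z z' ≤ N :=
  Nat.sInf_le ⟨x, x, v, w, hz, hz', Multiset.rel_refl_of_refl_on fun _ _ => Associated.refl _,
    max_le hv hw⟩

theorem exists_of_fdistD_le {z z' : Multiset R} {N : ℕ} (h : fdistD R z z' ≤ N) :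
    ∃ x x' v w : Multiset R, z = x + v ∧ z' = x' + w ∧
      Multiset.Rel Associated x x' ∧ Multiset.card v ≤ N ∧ Multiset.card w ≤ N := by
  have hmem := Nat.sInf_mem (s := {N : ℕ | ∃ x x' v w : Multiset R, z = x + v ∧ z' = x' + w ∧
    Multiset.Rel Associated x x' ∧ max (Multiset.card v) (Multiset.card w) ≤ N})
    ⟨_, 0, 0, z, z', by simp, by simp, Multiset.Rel.zero, le_rfl⟩
  obtain ⟨x, x', v, w, hz, hz', hx, hc⟩ := hmem
  exact ⟨x, x', v, w, hz, hz', hx, (le_max_left _ _).trans (hc.trans h),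
    (le_max_right _ _).trans (hc.trans h)⟩

/-- If `u` divides every product of `N` irreducibles, and the cofactors of `u` in products of at
most `N` irreducibles have factorizations of length at most `B`, then the local tame degree of
`u` is at most `max N (B + 1)`. -/
theorem tameBoundD_of_dvd_prod {u : R} (hu : Irreducible u) {N B : ℕ}
    (hN : ∀ s : Multiset R, (∀ v ∈ s, Irreducible v) → Multiset.card s = N → u ∣ s.prod)
    (hB : ∀ (s : Multiset R) (b : R), (∀ v ∈ s, Irreducible v) → Multiset.card s ≤ N →
      s.prod = u * b → ∃ t, IsFactorizationD R b t ∧ Multiset.card t ≤ B) :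
    TameBoundD R u (max N (B + 1)) := by
  intro a _ hua z hz
  obtain ⟨y, x, rfl, hyN, huy⟩ : ∃ y x : Multiset R, z = x + y ∧ Multiset.card y ≤ N ∧
      u ∣ y.prod := by
    rcases le_total (Multiset.card z) N with h | h
    · exact ⟨z, 0, by simp, h, hua.trans hz.2.symm.dvd⟩
    · have hpos : 0 < Multiset.card (Multiset.powersetCard N z) := by
        rw [Multiset.card_powersetCard]; exact Nat.choose_pos h
      obtain ⟨y, hy⟩ := Multiset.card_pos_iff_exists_mem.1 hpos
      obtain ⟨hyz, hyN⟩ := Multiset.mem_powersetCard.1 hy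
      obtain ⟨x, rfl⟩ := Multiset.le_iff_exists_add.1 hyz
      exact ⟨y, x, add_comm _ _, hyN.le,
        hN y (fun v hv => hz.1 v (Multiset.mem_add.2 (Or.inl hv))) hyN⟩
  have hy : ∀ v ∈ y, Irreducible v := fun v hv => hz.1 v (Multiset.mem_add.2 (Or.inr hv))
  have hx : ∀ v ∈ x, Irreducible v := fun v hv => hz.1 v (Multiset.mem_add.2 (Or.inl hv))
  obtain ⟨b, hb⟩ := huy
  obtain ⟨t, ht, htB⟩ := hB y b hy hyN hb
  refine ⟨x + u ::ₘ t, ⟨fun v hv => ?_, ?_⟩, ⟨u, by simp, Associated.refl u⟩,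
    fdistD_le x y (u ::ₘ t) rfl rfl (hyN.trans (le_max_left _ _)) ?_⟩
  · rcases Multiset.mem_add.1 hv with h | h
    · exact hx v h
    · rcases Multiset.mem_cons.1 h with rfl | h
      exacts [hu, ht.1 v h]
  · refine Associated.trans ?_ hz.2
    rw [Multiset.prod_add, Multiset.prod_add, Multiset.prod_cons, hb]
    exact (Associated.refl _).mul_mul ((Associated.refl _).mul_mul ht.2)
  · rw [Multiset.card_cons]
    exact (Nat.add_le_add_right htB 1).trans (le_max_right _ _)

theorem LambdaD_ne_top_of_forall {N : ℕ}
    (h : ∀ a : R, a ≠ 0 → ∃ z, IsFactorizationD R a z ∧ Multiset.card z ≤ N) :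
    LambdaD R ≠ ⊤ := by
  refine ne_top_of_le_ne_top (ENat.natCast_ne_top N) ?_
  refine iSup_le fun a => iSup_le fun ha => iSup_le fun _ => ?_
  obtain ⟨z, hz, hzN⟩ := h a ha
  exact_mod_cast (Nat.sInf_le (s := lengthSetD R a) ⟨z, rfl, hz.1, hz.2⟩).trans hzN

theorem exists_forall_factorization_le [WfDvdMonoid R] (h : LambdaD R ≠ ⊤) :
    ∃ N : ℕ, ∀ a : R, a ≠ 0 → ∃ z, IsFactorizationD R a z ∧ Multiset.card z ≤ N := by
  obtain ⟨N, hN⟩ := ENat.ne_top_iff_exists.1 h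
  refine ⟨N, fun a ha => ?_⟩
  obtain ⟨f, hf⟩ := WfDvdMonoid.exists_factors a ha
  have hne : (lengthSetD R a).Nonempty := ⟨_, f, rfl, hf⟩
  obtain ⟨z, hz, hz'⟩ := Nat.sInf_mem hne
  refine ⟨z, hz', ?_⟩
  have : ((sInf (lengthSetD R a) : ℕ) : ℕ∞) ≤ LambdaD R :=
    le_iSup_of_le a (le_iSup_of_le ha (le_iSup_of_le hne le_rfl))
  rw [← hN, ← hz] at this
  exact_mod_cast this

/-- In a globally tame domain the minimal lengths of the powers of an irreducible are
unbounded. -/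
theorem GloballyTameD.LambdaD_eq_top [IsDomain R] [WfDvdMonoid R] (h : GloballyTameD R)
    {p : R} (hp : Irreducible p) : LambdaD R = ⊤ := by
  by_contra hΛ
  obtain ⟨B, hB⟩ := exists_forall_factorization_le hΛ
  obtain ⟨N, hN⟩ := h
  have hne : p ^ ((N + 1) * B + 1) ≠ 0 := pow_ne_zero _ hp.ne_zero
  obtain ⟨z, hz, hzB⟩ := hB _ hne
  have key : ∀ u ∈ z, u ∣ p ^ (N + 1) := by
    intro u hu
    obtain ⟨z', hz', ⟨v, hv, hvu⟩, hd⟩ := hN u (hz.1 u hu) _ hne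
      ((Multiset.dvd_prod hu).trans hz.2.dvd) _ (isFactorizationD_replicate hp _)
    obtain ⟨x, x', y, w, hx, rfl, hxx, hy, -⟩ := exists_of_fdistD_le hd
    have hp' : ∀ q ∈ x + y, q = p := fun q hq => Multiset.eq_of_mem_replicate (hx ▸ hq)
    refine hvu.symm.dvd.trans ?_
    rcases Multiset.mem_add.1 hv with h | h
    · obtain ⟨q, hq, hqv⟩ := Multiset.exists_mem_of_rel_of_mem
        ((Multiset.rel_flip (r := Associated)).2 hxx) h
      rw [hp' q (Multiset.mem_add.2 (Or.inl hq))] at hqv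
      exact (show Associated p v from hqv).symm.dvd.trans (dvd_pow_self p N.succ_ne_zero)
    · have hprod : Associated (x.prod * y.prod) (x'.prod * w.prod) := by
        rw [← Multiset.prod_add, ← Multiset.prod_add, ← hx, Multiset.prod_replicate]
        exact hz'.2.symm
      have hx0 : x.prod ≠ 0 := fun h0 => by
        have := hp' 0 (Multiset.mem_add.2 (Or.inl (Multiset.prod_eq_zero_iff.1 h0)))
        exact hp.ne_zero this.symm
      have hxx' : Associated x.prod x'.prod := by
        clear * - hxx
        induction hxx with
        | zero => simp
        | cons h _ ih => simpa using h.mul_mul ih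
      have hyw := hprod.of_mul_left hxx' hx0
      rw [Multiset.eq_replicate_card.2 fun q hq => hp' q (Multiset.mem_add.2 (Or.inr hq)),
        Multiset.prod_replicate] at hyw
      exact (Multiset.dvd_prod h).trans (hyw.symm.dvd.trans (pow_dvd_pow p (hy.trans N.le_succ)))
  have hle : p ^ ((N + 1) * B + 1) ∣ p ^ ((N + 1) * B) := by
    refine hz.2.symm.dvd.trans ?_
    have h := Multiset.prod_dvd_prod_of_dvd id (fun _ => p ^ (N + 1)) key
    rw [Multiset.map_id, Multiset.map_const', Multiset.prod_replicate, ← pow_mul] at h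
    exact h.trans (pow_dvd_pow p (Nat.mul_le_mul_left _ hzB))
  have := (pow_dvd_pow_iff hp.ne_zero hp.not_isUnit).1 hle
  omega

end Factorizations

section StronglyPrimary

variable {R : Type*} [CommRing R] [IsLocalRing R]

theorem multiset_prod_mem_maximalIdeal_pow {s : Multiset R} (hs : ∀ v ∈ s, ¬ IsUnit v) :
    s.prod ∈ maximalIdeal R ^ Multiset.card s := by
  induction s using Multiset.induction with
  | empty => simp
  | cons a s ih =>
    rw [Multiset.prod_cons, Multiset.card_cons, pow_succ']
    exact Ideal.mul_mem_mul ((mem_maximalIdeal a).2 (hs a (Multiset.mem_cons_self a s)))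
      (ih fun v hv => hs v (Multiset.mem_cons_of_mem hv))

theorem IsFactorizationD.card_lt {p c : R} {M q : ℕ}
    (hM : maximalIdeal R ^ M ≤ Ideal.span {p}) (hc : ¬ p ^ q ∣ c) {z : Multiset R}
    (hz : IsFactorizationD R c z) : Multiset.card z < M * q := by
  by_contra! hlt
  refine hc (dvd_trans ?_ hz.2.dvd)
  rw [← Ideal.mem_span_singleton, ← Ideal.span_singleton_pow]
  refine Ideal.pow_right_mono hM q ?_
  rw [← pow_mul]
  exact Ideal.pow_le_pow_right hlt (multiset_prod_mem_maximalIdeal_pow fun v hv =>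
    (hz.1 v hv).not_isUnit)

variable [IsDomain R]

theorem StronglyPrimaryDomain.exists_notMem_pow_s9 (h : StronglyPrimaryDomain R) {a : R}
    (ha : a ≠ 0) : ∃ n : ℕ, a ∉ maximalIdeal R ^ n := by
  obtain ⟨n, -, hn⟩ := h.2 a ha
  refine ⟨n + 1, fun hmem => ?_⟩
  rw [pow_succ, mul_comm] at hmem
  obtain ⟨c, hc, hca⟩ := Ideal.mem_mul_span_singleton.1 (Ideal.mul_mono_right hn hmem)
  have : c = 1 := mul_right_cancel₀ ha (by rw [hca, one_mul])
  exact (Ideal.ne_top_iff_one _).1 (IsLocalRing.maximalIdeal.isMaximal R).ne_top (this ▸ hc)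

theorem StronglyPrimaryDomain.wfDvdMonoid (h : StronglyPrimaryDomain R) : WfDvdMonoid R := by
  have key : ∀ (n : ℕ) (a : R), a ∉ maximalIdeal R ^ n → Acc DvdNotUnit a := by
    intro n
    induction n with
    | zero => intro a ha; simp at ha
    | succ n ih =>
      refine fun a ha => Acc.intro a fun b hb => ih b fun hbn => ha ?_
      obtain ⟨-, c, hc, rfl⟩ := hb
      rw [pow_succ]
      exact Ideal.mul_mem_mul hbn ((mem_maximalIdeal c).2 hc)
  have key' : ∀ a : R, a ≠ 0 → Acc DvdNotUnit a := fun a ha =>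
    let ⟨n, hn⟩ := h.exists_notMem_pow_s9 ha
    key n a hn
  exact ⟨⟨fun a => Acc.intro a fun b hb => key' b hb.1⟩⟩

theorem locallyTameD_of_LambdaD_ne_top (h : StronglyPrimaryDomain R) (hΛ : LambdaD R ≠ ⊤) :
    LocallyTameD R := by
  have := h.wfDvdMonoid
  obtain ⟨B, hB⟩ := exists_forall_factorization_le hΛ
  intro u hu
  obtain ⟨N, -, hN⟩ := h.2 u hu.ne_zero
  refine ⟨_, tameBoundD_of_dvd_prod hu (N := N) (B := B) (fun s hs hc => ?_)
    fun s b hs _ hb => hB b ?_⟩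
  · exact Ideal.mem_span_singleton.1 (hN (hc ▸ multiset_prod_mem_maximalIdeal_pow fun v hv =>
      (hs v hv).not_isUnit))
  · rintro rfl
    rw [mul_zero, Multiset.prod_eq_zero_iff] at hb
    exact (hs 0 hb).ne_zero rfl

/-- If all irreducibles divide a fixed power of `p`, the domain is globally tame. -/
theorem globallyTameD_of_forall_dvd_pow (h : StronglyPrimaryDomain R) {p : R}
    (hp : Irreducible p) {n : ℕ} (hn : ∀ u : R, Irreducible u → u ∣ p ^ n) :
    GloballyTameD R := by
  have := h.wfDvdMonoid
  obtain ⟨N, -, hN⟩ := h.2 (p ^ n) (pow_ne_zero n hp.ne_zero)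
  obtain ⟨M, -, hM⟩ := h.2 p hp.ne_zero
  refine ⟨max N (M * (n * N + 1) + 1), fun u hu => tameBoundD_of_dvd_prod hu
    (fun s hs hc => ?_) fun s b hs hc hb => ?_⟩
  · exact (hn u hu).trans (Ideal.mem_span_singleton.1 (hN (hc ▸
      multiset_prod_mem_maximalIdeal_pow fun v hv => (hs v hv).not_isUnit)))
  · have hbs : b ∣ p ^ (n * N) := by
      refine (Dvd.intro_left u hb.symm).trans ?_
      have hd := Multiset.prod_dvd_prod_of_dvd id (fun _ => p ^ n) fun v hv => hn v (hs v hv)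
      rw [Multiset.map_id, Multiset.map_const', Multiset.prod_replicate, ← pow_mul] at hd
      exact hd.trans (pow_dvd_pow p (Nat.mul_le_mul_left _ hc))
    have hb0 : b ≠ 0 := ne_zero_of_dvd_ne_zero (pow_ne_zero _ hp.ne_zero) hbs
    obtain ⟨t, ht⟩ := WfDvdMonoid.exists_factors b hb0
    refine ⟨t, ht, (IsFactorizationD.card_lt hM (fun hd => ?_) ht).le⟩
    have := (pow_dvd_pow_iff hp.ne_zero hp.not_isUnit).1 (hd.trans hbs)
    omega

/-- If every power of `p` is, up to boundedly many factors `p`, a product of two elements not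
divisible by `p`, then `Λ` is finite. -/
theorem LambdaD_ne_top_of_pow_eq_mul (h : StronglyPrimaryDomain R) {p : R}
    (hp : Irreducible p) {G : ℕ}
    (hG : ∀ i : ℕ, ∃ j r s, j ≤ G ∧ p ^ i = p ^ j * (r * s) ∧ ¬ p ∣ r ∧ ¬ p ∣ s) :
    LambdaD R ≠ ⊤ := by
  have := h.wfDvdMonoid
  obtain ⟨M, -, hM⟩ := h.2 p hp.ne_zero
  have bound : ∀ c : R, ¬ p ∣ c → ∃ z, IsFactorizationD R c z ∧ Multiset.card z ≤ M := by
    intro c hc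
    obtain ⟨z, hz⟩ := WfDvdMonoid.exists_factors c fun h0 => hc (h0 ▸ dvd_zero p)
    have := IsFactorizationD.card_lt (q := 1) hM (by rwa [pow_one]) hz
    exact ⟨z, hz, by omega⟩
  refine LambdaD_ne_top_of_forall (N := 3 * M + G) fun a ha => ?_
  obtain ⟨i, c, hc, rfl⟩ := WfDvdMonoid.max_power_factor ha hp
  obtain ⟨j, r, s, hj, hi, hr, hs⟩ := hG i
  obtain ⟨x, hx, hxM⟩ := bound c hc
  obtain ⟨y, hy, hyM⟩ := bound r hr
  obtain ⟨z, hz, hzM⟩ := bound s hs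
  refine ⟨_, hi ▸ ((isFactorizationD_replicate hp j).add (hy.add hz)).add hx, ?_⟩
  simp only [Multiset.card_add, Multiset.card_replicate]
  omega

end StronglyPrimary

section Order

variable {R : Type*} [CommRing R] {K : Type*} [Field K] [Algebra R K]

/-- The fractional ideal `p ^ j R`. -/
def principalFiltration (K : Type*) [Field K] [Algebra R K] (p : R) (j : ℤ) : Submodule R K :=
  Submodule.span R {algebraMap R K p ^ j}

/-- The largest `j` with `x ∈ p ^ j R`. -/
noncomputable def principalOrder (p : R) (x : K) : ℤ :=
  sSup {j : ℤ | x ∈ principalFiltration K p j}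

/-- The failure of `principalOrder p` to be additive on `x` and `x⁻¹`. -/
noncomputable def orderDefect (p : R) (x : K) : ℤ :=
  -principalOrder p x - principalOrder p x⁻¹

/-- A nonzero nonunit such that every nonzero element divides one of its powers. -/
structure IsAbsorbing (p : R) : Prop where
  ne_zero : p ≠ 0
  not_isUnit : ¬ IsUnit p
  exists_dvd_pow : ∀ r : R, r ≠ 0 → ∃ n : ℕ, r ∣ p ^ n

theorem mem_principalFiltration {p : R} {j : ℤ} {x : K} :
    x ∈ principalFiltration K p j ↔ ∃ r : R, algebraMap R K r * algebraMap R K p ^ j = x := by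
  simp [principalFiltration, Submodule.mem_span_singleton, Algebra.smul_def]

theorem mul_mem_principalFiltration {p : R} (hp : algebraMap R K p ≠ 0) {i j : ℤ} {x y : K}
    (hx : x ∈ principalFiltration K p i) (hy : y ∈ principalFiltration K p j) :
    x * y ∈ principalFiltration K p (i + j) := by
  rw [mem_principalFiltration] at *
  obtain ⟨r, rfl⟩ := hx
  obtain ⟨s, rfl⟩ := hy
  exact ⟨r * s, by rw [map_mul, zpow_add₀ hp]; ring⟩

theorem zpow_mem_principalFiltration (p : R) (j : ℤ) :
    algebraMap R K p ^ j ∈ principalFiltration K p j :=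
  Submodule.mem_span_singleton_self _

theorem principalFiltration_antitone {p : R} (hp : algebraMap R K p ≠ 0) :
    Antitone (principalFiltration K p) := by
  intro i j hij x hx
  rw [mem_principalFiltration] at *
  obtain ⟨r, rfl⟩ := hx
  obtain ⟨n, rfl⟩ := Int.le.dest hij
  exact ⟨r * p ^ n, by rw [map_mul, map_pow, zpow_add₀ hp, zpow_natCast]; ring⟩

theorem mem_principalFiltration_zero {p : R} {x : K} :
    x ∈ principalFiltration K p 0 ↔ ∃ r : R, algebraMap R K r = x := by
  simp [mem_principalFiltration]

/-- An element all of whose powers have order bounded below has a power whose order is minimal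
among the orders of its own powers. -/
theorem exists_pow_principalOrder_minimal (p : R) {z : K} {c : ℤ}
    (hc : ∀ i : ℕ, c ≤ principalOrder p (z ^ i)) :
    ∃ j : ℕ, ∀ i : ℕ, principalOrder p (z ^ j) ≤ principalOrder p (z ^ i) := by
  obtain ⟨_, ⟨j, rfl⟩, hj⟩ := Int.exists_least_of_bdd
    (P := fun n => ∃ i : ℕ, principalOrder p (z ^ i) = n)
    ⟨c, by rintro _ ⟨i, rfl⟩; exact hc i⟩ ⟨_, 0, rfl⟩
  exact ⟨j, fun i => hj _ ⟨i, rfl⟩⟩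

theorem unit_mul_mem_principalFiltration {p : R} {u : R} (hu : IsUnit u) {x : K} {j : ℤ} :
    algebraMap R K u * x ∈ principalFiltration K p j ↔ x ∈ principalFiltration K p j := by
  rw [← Algebra.smul_def]
  obtain ⟨u, rfl⟩ := hu
  exact Submodule.smul_mem_iff_of_isUnit _ u.isUnit

variable [IsFractionRing R K] {p : R}

theorem algebraMap_mem_principalFiltration_natCast {r : R} {n : ℕ} :
    algebraMap R K r ∈ principalFiltration K p n ↔ p ^ n ∣ r := by
  rw [mem_principalFiltration]
  constructor
  · rintro ⟨s, hs⟩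
    refine ⟨s, IsFractionRing.injective R K ?_⟩
    rw [← hs, map_mul, map_pow, zpow_natCast, mul_comm]
  · rintro ⟨s, rfl⟩
    exact ⟨s, by rw [map_mul, map_pow, zpow_natCast, mul_comm]⟩

namespace IsAbsorbing

theorem algebraMap_ne_zero (hp : IsAbsorbing p) : algebraMap R K p ≠ 0 := by
  simpa using hp.ne_zero

variable [IsDomain R]

theorem exists_mem_principalFiltration (hp : IsAbsorbing p) (x : K) :
    ∃ j, x ∈ principalFiltration K p j := by
  obtain ⟨a, b, hb, rfl⟩ := IsFractionRing.div_surjective (A := R) x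
  have hb0 := nonZeroDivisors.ne_zero hb
  obtain ⟨n, c, hc⟩ := hp.exists_dvd_pow b hb0
  have hb' : algebraMap R K b ≠ 0 := by simpa using hb0
  refine ⟨-n, mem_principalFiltration.2 ⟨a * c, ?_⟩⟩
  have hpn : algebraMap R K p ^ n ≠ 0 := pow_ne_zero _ hp.algebraMap_ne_zero
  rw [zpow_neg, zpow_natCast, ← div_eq_mul_inv, div_eq_div_iff hpn hb', ← map_pow, hc]
  simp only [map_mul]
  ring

theorem exists_bound (hp : IsAbsorbing p) {x : K} (hx : x ≠ 0) :
    ∃ b : ℤ, ∀ j, x ∈ principalFiltration K p j → j ≤ b := by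
  obtain ⟨i, hi⟩ := hp.exists_mem_principalFiltration (R := R) x⁻¹
  refine ⟨-i, fun j hj => ?_⟩
  have h := mul_mem_principalFiltration hp.algebraMap_ne_zero hj hi
  rw [mul_inv_cancel₀ hx] at h
  by_contra! hlt
  have h1 := principalFiltration_antitone hp.algebraMap_ne_zero
    (show ((1 : ℕ) : ℤ) ≤ j + i by push_cast; omega) h
  rw [← map_one (algebraMap R K),
    algebraMap_mem_principalFiltration_natCast, pow_one] at h1
  exact hp.not_isUnit (isUnit_of_dvd_one h1)

theorem le_principalOrder_iff (hp : IsAbsorbing p) {x : K} (hx : x ≠ 0) {j : ℤ} :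
    j ≤ principalOrder p x ↔ x ∈ principalFiltration K p j := by
  have hbdd : BddAbove {j : ℤ | x ∈ principalFiltration K p j} := hp.exists_bound hx
  constructor
  · intro h
    exact principalFiltration_antitone hp.algebraMap_ne_zero h
      (Int.csSup_mem (hp.exists_mem_principalFiltration x) hbdd)
  · exact fun h => le_csSup hbdd h

theorem mem_principalFiltration_principalOrder (hp : IsAbsorbing p) {x : K} (hx : x ≠ 0) :
    x ∈ principalFiltration K p (principalOrder p x) :=
  (hp.le_principalOrder_iff hx).1 le_rfl

theorem principalOrder_eq_iff (hp : IsAbsorbing p) {x : K} (hx : x ≠ 0) {j : ℤ} :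
    principalOrder p x = j ↔
      x ∈ principalFiltration K p j ∧ x ∉ principalFiltration K p (j + 1) := by
  rw [← hp.le_principalOrder_iff hx, ← hp.le_principalOrder_iff hx]
  omega

theorem principalOrder_add_le_mul (hp : IsAbsorbing p) {x y : K} (hx : x ≠ 0) (hy : y ≠ 0) :
    principalOrder p x + principalOrder p y ≤ principalOrder p (x * y) :=
  (hp.le_principalOrder_iff (mul_ne_zero hx hy)).2
    (mul_mem_principalFiltration hp.algebraMap_ne_zero
      (hp.mem_principalFiltration_principalOrder hx)
      (hp.mem_principalFiltration_principalOrder hy))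

theorem principalOrder_one (hp : IsAbsorbing p) : principalOrder p (1 : K) = 0 := by
  rw [hp.principalOrder_eq_iff one_ne_zero]
  refine ⟨mem_principalFiltration_zero.2 ⟨1, map_one _⟩, fun h => hp.not_isUnit ?_⟩
  rw [← map_one (algebraMap R K), show (0 : ℤ) + 1 = ((1 : ℕ) : ℤ) by norm_num,
    algebraMap_mem_principalFiltration_natCast, pow_one] at h
  exact isUnit_of_dvd_one h

theorem principalOrder_zpow_mul (hp : IsAbsorbing p) {x : K} (hx : x ≠ 0) (k : ℤ) :
    principalOrder p (algebraMap R K p ^ k * x) = k + principalOrder p x := by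
  have hle : ∀ (k : ℤ) (y : K), y ≠ 0 →
      k + principalOrder p y ≤ principalOrder p (algebraMap R K p ^ k * y) := fun k y hy =>
    (hp.le_principalOrder_iff (mul_ne_zero (zpow_ne_zero k hp.algebraMap_ne_zero) hy)).2
      (mul_mem_principalFiltration hp.algebraMap_ne_zero (zpow_mem_principalFiltration p k)
        (hp.mem_principalFiltration_principalOrder hy))
  have h := hle (-k) _ (mul_ne_zero (zpow_ne_zero k (hp.algebraMap_ne_zero (K := K))) hx)
  rw [← mul_assoc, ← zpow_add₀ hp.algebraMap_ne_zero, neg_add_cancel, zpow_zero, one_mul] at h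
  linarith [hle k x hx]

theorem mul_principalOrder_le_pow (hp : IsAbsorbing p) {x : K} (hx : x ≠ 0) (k : ℕ) :
    k * principalOrder p x ≤ principalOrder p (x ^ k) := by
  induction k with
  | zero => simp [hp.principalOrder_one]
  | succ k ih =>
    rw [pow_succ]
    push_cast
    linarith [hp.principalOrder_add_le_mul (pow_ne_zero k hx) hx]

theorem orderDefect_mul_le (hp : IsAbsorbing p) {x y : K} (hx : x ≠ 0) (hy : y ≠ 0) :
    orderDefect p (x * y) ≤ orderDefect p x + orderDefect p y := by
  unfold orderDefect
  rw [mul_inv]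
  linarith [hp.principalOrder_add_le_mul hx hy,
    hp.principalOrder_add_le_mul (inv_ne_zero hx) (inv_ne_zero hy)]

theorem orderDefect_one (hp : IsAbsorbing p) : orderDefect p (1 : K) = 0 := by
  simp [orderDefect, hp.principalOrder_one]

theorem orderDefect_nonneg (hp : IsAbsorbing p) {x : K} (hx : x ≠ 0) : 0 ≤ orderDefect p x := by
  have := hp.principalOrder_add_le_mul hx (inv_ne_zero hx)
  rw [mul_inv_cancel₀ hx, hp.principalOrder_one] at this
  unfold orderDefect
  linarith

/-- The power `p ^ d`, where `d` is the defect of `x`, is a product of two elements of order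
zero. -/
theorem exists_pow_eq_mul (hp : IsAbsorbing p) {x : K} (hx : x ≠ 0) {d : ℕ}
    (hd : orderDefect p x = d) : ∃ r s : R, p ^ d = r * s ∧ ¬ p ∣ r ∧ ¬ p ∣ s := by
  have key : ∀ y : K, y ≠ 0 → ∃ r : R,
      algebraMap R K r = algebraMap R K p ^ (-principalOrder p y) * y ∧ ¬ p ∣ r := by
    intro y hy
    have hne : algebraMap R K p ^ (-principalOrder p y) * y ≠ 0 :=
      mul_ne_zero (zpow_ne_zero _ hp.algebraMap_ne_zero) hy
    have h0 := hp.principalOrder_zpow_mul hy (-principalOrder p y)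
    rw [neg_add_cancel, hp.principalOrder_eq_iff hne] at h0
    obtain ⟨r, hr⟩ := mem_principalFiltration_zero.1 h0.1
    refine ⟨r, hr, fun hpr => h0.2 ?_⟩
    rw [← hr, show (0 : ℤ) + 1 = ((1 : ℕ) : ℤ) by norm_num,
      algebraMap_mem_principalFiltration_natCast, pow_one]
    exact hpr
  obtain ⟨r, hr, hpr⟩ := key x hx
  obtain ⟨s, hs, hps⟩ := key x⁻¹ (inv_ne_zero hx)
  refine ⟨r, s, IsFractionRing.injective R K ?_, hpr, hps⟩
  rw [map_mul, hr, hs, map_pow, ← zpow_natCast, ← hd, orderDefect, sub_eq_add_neg,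
    zpow_add₀ hp.algebraMap_ne_zero]
  field_simp

/-- If the defects of `x ^ k` are unbounded, they have bounded gaps. -/
theorem exists_orderDefect_pow_mem (hp : IsAbsorbing p) {x : K} (hx : x ≠ 0) {i : ℕ}
    (hk : ∃ k : ℕ, (i : ℤ) < orderDefect p (x ^ k)) :
    ∃ y : K, y ≠ 0 ∧ orderDefect p y ≤ i ∧ i ≤ orderDefect p y + orderDefect p x := by
  classical
  obtain ⟨k, hk', hmin⟩ : ∃ k : ℕ, (i : ℤ) < orderDefect p (x ^ k) ∧
      ∀ m < k, ¬ (i : ℤ) < orderDefect p (x ^ m) :=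
    ⟨Nat.find hk, Nat.find_spec hk, fun m hm => Nat.find_min hk hm⟩
  rcases k with _ | k
  · rw [pow_zero, hp.orderDefect_one] at hk'
    omega
  · refine ⟨x ^ k, pow_ne_zero k hx, not_lt.1 (hmin k k.lt_succ_self), hk'.le.trans ?_⟩
    rw [pow_succ]
    exact hp.orderDefect_mul_le (pow_ne_zero k hx) hx

/-- If `y` has order `-n < 0`, its higher powers have larger order, and some power of it lies in
`pR`, then `1 + y` has defect `2n`. -/
theorem orderDefect_one_add [IsLocalRing R] (hp : IsAbsorbing p) {y : K} {n : ℤ} (hn : 0 < n)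
    (hy : y ∈ principalFiltration K p (-n)) (hy' : y ∉ principalFiltration K p (-n + 1))
    (hpow : ∀ i : ℕ, 2 ≤ i → y ^ i ∈ principalFiltration K p (-n + 1))
    {k : ℕ} (hk : 2 ≤ k) (hyk : y ^ k ∈ principalFiltration K p 1) :
    1 + y ≠ 0 ∧ orderDefect p (1 + y) = 2 * n := by
  have hanti := principalFiltration_antitone (K := K) hp.algebraMap_ne_zero
  have one_mem : (1 : K) ∈ principalFiltration K p (-n + 1) :=
    hanti (show -n + 1 ≤ 0 by omega) (mem_principalFiltration_zero.2 ⟨1, map_one _⟩)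
  have lt : principalFiltration K p (-n + 1) ≤ principalFiltration K p (-n) :=
    hanti (by omega)
  have h1 : 1 + y ∈ principalFiltration K p (-n) := add_mem (lt one_mem) hy
  have h1' : 1 + y ∉ principalFiltration K p (-n + 1) := fun h =>
    hy' ((Submodule.add_mem_iff_right _ one_mem).1 h)
  have hne : 1 + y ≠ 0 := fun h => h1' (h ▸ zero_mem _)
  refine ⟨hne, ?_⟩
  obtain ⟨k, rfl⟩ := Nat.exists_eq_add_of_le hk
  have hneg : ∀ (i : ℕ) (j : ℤ), y ^ i ∈ principalFiltration K p j →
      (-y) ^ i ∈ principalFiltration K p j := by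
    intro i j h
    rcases Nat.even_or_odd i with hi | hi
    · rwa [hi.neg_pow]
    · rw [hi.neg_pow]; exact neg_mem h
  set g : K := ∑ i ∈ Finset.range (2 + k), (-y) ^ i with hg
  have hgtail : g + y ∈ principalFiltration K p (-n + 1) := by
    rw [hg, Finset.sum_range_add]
    have h2 : ∑ i ∈ Finset.range 2, (-y) ^ i = 1 - y := by
      simp [Finset.sum_range_succ, sub_eq_add_neg]
    rw [h2]
    have : 1 - y + ∑ i ∈ Finset.range k, (-y) ^ (2 + i) + y =
        1 + ∑ i ∈ Finset.range k, (-y) ^ (2 + i) := by ring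
    rw [this]
    exact add_mem one_mem (sum_mem fun i _ => hneg _ _ (hpow _ (by omega)))
  have h2 : g ∈ principalFiltration K p (-n) := by
    have := sub_mem (lt hgtail) hy
    rwa [add_sub_cancel_right] at this
  have h2' : g ∉ principalFiltration K p (-n + 1) := fun h =>
    hy' ((Submodule.add_mem_iff_right _ h).1 hgtail)
  obtain ⟨r, hr⟩ := mem_principalFiltration.1 (hneg _ _ hyk)
  have hu : IsUnit (1 - r * p) := by
    have hm : r * p ∈ nonunits R := fun h => hp.not_isUnit (isUnit_of_mul_isUnit_right h)
    exact isUnit_one_sub_self_of_mem_nonunits _ hm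
  have hmul : (1 + y) * g = algebraMap R K (1 - r * p) := by
    have := mul_neg_geom_sum (-y) (2 + k)
    rw [sub_neg_eq_add, ← hr, zpow_one] at this
    rw [hg, this, map_sub, map_one, map_mul]
  have hginv : g = algebraMap R K (1 - r * p) * (1 + y)⁻¹ := by
    rw [← hmul]; field_simp
  rw [hginv, unit_mul_mem_principalFiltration hu] at h2 h2'
  have e1 := (hp.principalOrder_eq_iff hne).2 ⟨h1, h1'⟩
  have e2 := (hp.principalOrder_eq_iff (inv_ne_zero hne)).2 ⟨h2, h2'⟩
  rw [orderDefect, e1, e2]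
  ring

/-- If there are power-bounded elements of arbitrarily negative order (that is, the conductor of
the complete integral closure vanishes), then every even number is a defect. -/
theorem exists_orderDefect_eq_two_mul [IsLocalRing R] (hp : IsAbsorbing p)
    (h : ∀ N : ℤ, ∃ z : K, z ≠ 0 ∧ principalOrder p z < N ∧
      ∃ c : ℤ, ∀ i : ℕ, c ≤ principalOrder p (z ^ i)) (n : ℕ) :
    ∃ x : K, x ≠ 0 ∧ orderDefect p x = 2 * n := by
  rcases Nat.eq_zero_or_pos n with rfl | hn
  · exact ⟨1, one_ne_zero, by simp [hp.orderDefect_one]⟩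
  obtain ⟨z₀, hz₀, hzn, c, hc⟩ := h (-n)
  obtain ⟨j, hj⟩ := exists_pow_principalOrder_minimal p hc
  set z := z₀ ^ j with hz
  have hz0 : z ≠ 0 := pow_ne_zero j hz₀
  set N : ℤ := -principalOrder p z with hN
  have hnN : (n : ℤ) < N := by
    have := hj 1
    rw [pow_one] at this
    omega
  have hzi : ∀ i : ℕ, -N ≤ principalOrder p (z ^ i) := by
    intro i
    rw [hN, neg_neg, hz, ← pow_mul]
    exact hj _
  set y := algebraMap R K p ^ (N - n) * z with hy
  have hy0 : y ≠ 0 := mul_ne_zero (zpow_ne_zero _ hp.algebraMap_ne_zero) hz0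
  have hyi : ∀ i : ℕ, i * (N - n) - N ≤ principalOrder p (y ^ i) := by
    intro i
    rw [hy, mul_pow, ← zpow_natCast, ← zpow_mul, mul_comm (N - n : ℤ),
      hp.principalOrder_zpow_mul (pow_ne_zero i hz0)]
    linarith [hzi i]
  have hyo : principalOrder p y = -n := by
    rw [hy, hp.principalOrder_zpow_mul hz0]
    omega
  obtain ⟨h1, h1'⟩ := (hp.principalOrder_eq_iff hy0).1 hyo
  have hlarge : (1 : ℤ) ≤ principalOrder p (y ^ (N.toNat + 2)) := by
    refine le_trans ?_ (hyi _)
    push_cast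
    rw [Int.toNat_of_nonneg (by omega)]
    nlinarith
  have hpow : ∀ i : ℕ, 2 ≤ i → y ^ i ∈ principalFiltration K p (-n + 1) := by
    intro i hi
    refine (hp.le_principalOrder_iff (pow_ne_zero i hy0)).1 (le_trans ?_ (hyi i))
    have : (2 : ℤ) ≤ i := by exact_mod_cast hi
    nlinarith
  obtain ⟨hne, hd⟩ := hp.orderDefect_one_add (by exact_mod_cast hn) h1 h1' hpow
    (Nat.le_add_left 2 N.toNat) ((hp.le_principalOrder_iff (pow_ne_zero _ hy0)).1 hlarge)
  exact ⟨_, hne, hd⟩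

/-- If the orders of power-bounded elements are bounded below by `-C`, the order of `x ^ k` is
less than `k (ord x + C + 1)`. -/
theorem principalOrder_pow_lt (hp : IsAbsorbing p) {C : ℤ}
    (hC : ∀ z : K, z ≠ 0 → (∃ c : ℤ, ∀ i : ℕ, c ≤ principalOrder p (z ^ i)) →
      -C ≤ principalOrder p z) {x : K} (hx : x ≠ 0) {k : ℕ} (hk : 0 < k) :
    principalOrder p (x ^ k) < k * (principalOrder p x + C + 1) := by
  by_contra! hle
  set e := principalOrder p x + C + 1 with he
  set y := algebraMap R K p ^ (-e) * x with hy
  have hy0 : y ≠ 0 := mul_ne_zero (zpow_ne_zero _ hp.algebraMap_ne_zero) hx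
  have hyo : principalOrder p y = -C - 1 := by
    rw [hy, hp.principalOrder_zpow_mul hx]
    omega
  have hyk : 0 ≤ principalOrder p (y ^ k) := by
    rw [hy, mul_pow, ← zpow_natCast, ← zpow_mul, mul_comm (-e),
      hp.principalOrder_zpow_mul (pow_ne_zero k hx)]
    linarith
  have := hC y hy0 ⟨-(k * |principalOrder p y|), fun i => ?_⟩
  · omega
  · have h1 := hp.mul_principalOrder_le_pow (pow_ne_zero k hy0) (i / k)
    have h2 := hp.mul_principalOrder_le_pow hy0 (i % k)
    have h3 := hp.principalOrder_add_le_mul (pow_ne_zero (i / k) (pow_ne_zero k hy0))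
      (pow_ne_zero (i % k) hy0)
    rw [← pow_mul, ← pow_add, Nat.div_add_mod] at h3
    rw [← pow_mul] at h1
    have h4 : (0 : ℤ) ≤ (i / k : ℕ) * principalOrder p (y ^ k) :=
      mul_nonneg (Int.natCast_nonneg _) hyk
    have h5 : ((i % k : ℕ) : ℤ) ≤ k := by exact_mod_cast (Nat.mod_lt i hk).le
    have h6 : ((i % k : ℕ) : ℤ) * |principalOrder p y| ≤ k * |principalOrder p y| :=
      mul_le_mul_of_nonneg_right h5 (abs_nonneg _)
    have h7 : ((i % k : ℕ) : ℤ) * -|principalOrder p y| ≤ (i % k : ℕ) * principalOrder p y :=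
      mul_le_mul_of_nonneg_left (neg_abs_le _) (Int.natCast_nonneg _)
    rw [mul_neg] at h7
    linarith

/-- If the defects are unbounded, they have bounded gaps. -/
theorem exists_orderDefect_gap [IsLocalRing R] (hp : IsAbsorbing p)
    (hunb : ∀ n : ℤ, ∃ x : K, x ≠ 0 ∧ n < orderDefect p x) :
    ∃ G : ℕ, ∀ i : ℕ, ∃ x : K, x ≠ 0 ∧ orderDefect p x ≤ i ∧ i ≤ orderDefect p x + G := by
  by_cases h : ∀ N : ℤ, ∃ z : K, z ≠ 0 ∧ principalOrder p z < N ∧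
      ∃ c : ℤ, ∀ i : ℕ, c ≤ principalOrder p (z ^ i)
  · refine ⟨1, fun i => ?_⟩
    obtain ⟨x, hx, hd⟩ := hp.exists_orderDefect_eq_two_mul h (i / 2)
    exact ⟨x, hx, by omega, by omega⟩
  · push Not at h
    obtain ⟨N, hN⟩ := h
    have hC : ∀ z : K, z ≠ 0 → (∃ c : ℤ, ∀ i : ℕ, c ≤ principalOrder p (z ^ i)) →
        -(-N) ≤ principalOrder p z := by
      rintro z hz ⟨c, hc⟩
      by_contra! hlt
      obtain ⟨i, hi⟩ := hN z hz (by omega) c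
      exact absurd (hc i) (not_le.2 hi)
    obtain ⟨x, hx, hd⟩ := hunb (2 * -N + 2)
    refine ⟨(orderDefect p x).toNat, fun i => ?_⟩
    rw [Int.toNat_of_nonneg (hp.orderDefect_nonneg hx)]
    refine hp.exists_orderDefect_pow_mem hx ⟨i + 1, ?_⟩
    have h1 := hp.principalOrder_pow_lt hC hx i.succ_pos
    have h2 := hp.principalOrder_pow_lt hC (inv_ne_zero hx) i.succ_pos
    rw [inv_pow] at h2
    unfold orderDefect at hd ⊢
    push_cast at h1 h2 ⊢
    nlinarith

end IsAbsorbing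

end Order

/-- A strongly primary domain whose elements have unbounded minimal lengths is globally tame. -/
theorem globallyTameD_of_LambdaD_eq_top {R : Type*} [CommRing R] [IsDomain R] [IsLocalRing R]
    (h : StronglyPrimaryDomain R) {p : R} (hp : Irreducible p) (hΛ : LambdaD R = ⊤) :
    GloballyTameD R := by
  have hpa : IsAbsorbing p := ⟨hp.ne_zero, hp.not_isUnit, fun r hr => by
    obtain ⟨n, -, hn⟩ := h.2 r hr
    exact ⟨n, Ideal.mem_span_singleton.1
      (hn (Ideal.pow_mem_pow ((mem_maximalIdeal p).2 hp.not_isUnit) n))⟩⟩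
  by_cases hunb : ∀ n : ℤ, ∃ x : FractionRing R, x ≠ 0 ∧ n < orderDefect p x
  · obtain ⟨G, hG⟩ := hpa.exists_orderDefect_gap hunb
    refine absurd hΛ (LambdaD_ne_top_of_pow_eq_mul h hp (G := G) fun i => ?_)
    obtain ⟨x, hx, hxi, hix⟩ := hG i
    obtain ⟨d, hd⟩ := Int.eq_ofNat_of_zero_le (hpa.orderDefect_nonneg hx)
    obtain ⟨r, s, hrs, hr, hs⟩ := hpa.exists_pow_eq_mul hx hd
    refine ⟨i - d, r, s, by omega, ?_, hr, hs⟩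
    rw [← hrs, ← pow_add]
    congr 1
    omega
  · push Not at hunb
    obtain ⟨n, hn⟩ := hunb
    refine globallyTameD_of_forall_dvd_pow h hp (n := (n + 1).toNat) fun u hu => ?_
    set v := algebraMap R (FractionRing R) u with hv
    have hv0 : v ≠ 0 := by simpa [hv] using hu.ne_zero
    have hvo : principalOrder p v ≤ 1 := by
      by_contra! hlt
      have h2 := (hpa.le_principalOrder_iff hv0).1 (show ((2 : ℕ) : ℤ) ≤ _ from hlt)
      rw [hv, algebraMap_mem_principalFiltration_natCast] at h2
      obtain ⟨c, rfl⟩ := h2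
      rw [pow_two, mul_assoc] at hu
      rcases hu.isUnit_or_isUnit rfl with h' | h'
      · exact hp.not_isUnit h'
      · exact hp.not_isUnit (isUnit_of_mul_isUnit_left h')
    have hd := hn v hv0
    have hd0 := hpa.orderDefect_nonneg hv0
    unfold orderDefect at hd hd0
    have hinv := (hpa.le_principalOrder_iff (inv_ne_zero hv0)).1
      (show -((n + 1).toNat : ℤ) ≤ principalOrder p v⁻¹ by omega)
    obtain ⟨c, hc⟩ := mem_principalFiltration.1 hinv
    refine ⟨c, IsFractionRing.injective R (FractionRing R) ?_⟩
    have hpn : algebraMap R (FractionRing R) p ^ (n + 1).toNat ≠ 0 :=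
      pow_ne_zero _ hpa.algebraMap_ne_zero
    rw [zpow_neg, zpow_natCast] at hc
    rw [map_mul, map_pow, ← hv]
    field_simp at hc
    rw [← hc, mul_comm]

/-- Every one-dimensional local Mori domain `R` is locally tame;
moreover, `R` is globally tame if and only if `Λ(R) = ∞`. -/
theorem stmt9 (R : Type*) [CommRing R] [IsDomain R] [IsLocalRing R]
    (K : Type*) [Field K] [Algebra R K] [IsFractionRing R K]
    (hdim : ringKrullDim R = 1) (hMori : MoriDomain R K) :
    LocallyTameD R ∧ (GloballyTameD R ↔ LambdaD R = ⊤) := by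
  have h := hMori.stronglyPrimaryDomain hdim
  have := h.wfDvdMonoid
  obtain ⟨a, ham, ha⟩ := Submodule.exists_mem_ne_zero_of_ne_bot h.1
  obtain ⟨p, hp, -⟩ := WfDvdMonoid.exists_irreducible_factor ((mem_maximalIdeal a).1 ham) ha
  refine ⟨?_, fun hg => hg.LambdaD_eq_top hp, globallyTameD_of_LambdaD_eq_top h hp⟩
  by_cases hΛ : LambdaD R = ⊤
  · obtain ⟨N, hN⟩ := globallyTameD_of_LambdaD_eq_top h hp hΛ
    exact fun u hu => ⟨N, hN u hu⟩
  · exact locallyTameD_of_LambdaD_ne_top h hΛ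
end
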